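/- arXiv:1503.03091 — 4 statements merged into one kernel-verified Lean document; each statement's English description precedes it below -/
import Mathlib

section
/- Let α_1, α_2, α_3 ∈ 𝔻, ω_1, ω_2 ∈ 𝕋, γ ∈ 𝔻, and let F : 𝔻³ → 𝔻 be holomorphic with F(λ·m_{α_1}(λ), ω_1·λ·m_{α_2}(λ), ω_2·λ·m_{α_3}(λ)) = λ·m_γ(λ) for all λ ∈ 𝔻. Then γ is a convex combination of α_1, α_2, α_3, and for every t ∈ [0,1] and every λ ∈ 𝔻, F(λ·m_{t·α_1}(λ), ω_1·λ·m_{t·α_2}(λ), ω_2·λ·m_{t·α_3}(λ)) = λ·m_{t·γ}(λ). -/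
open Complex Set ComplexConjugate

noncomputable section

/-- The Möbius factor `m_a(l) = (a - l)/(1 - conj a · l)`. -/
def mob (a l : ℂ) : ℂ := (a - l) / (1 - conj a * l)

/-- The open unit disc in `ℂ`. -/
def uDisc : Set ℂ := {z : ℂ | ‖z‖ < 1}

/-- The open unit polydisc in `ℂⁿ`. -/
def uPolydisc (n : ℕ) : Set (Fin n → ℂ) := {z | ∀ i, ‖z i‖ < 1}

/-- `B` is (on the unit disc) a Blaschke product of degree exactly `d`. -/
def IsBlaschkeDeg (d : ℕ) (B : ℂ → ℂ) : Prop :=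
  ∃ c : ℂ, ‖c‖ = 1 ∧ ∃ a : Fin d → ℂ, (∀ j, ‖a j‖ < 1) ∧
    ∀ l ∈ uDisc, B l = c * ∏ j, mob (a j) l

/-- `B` is a Blaschke product of degree at most `k`. -/
def IsBlaschkeLe (k : ℕ) (B : ℂ → ℂ) : Prop := ∃ d ≤ k, IsBlaschkeDeg d B

/-- `F` is an interpolating function of the `N`-point Pick problem on `𝔻ⁿ` with
nodes `z j` and targets `lam j`. -/
def Interpolates (n N : ℕ) (z : Fin N → Fin n → ℂ) (lam : Fin N → ℂ)
    (F : (Fin n → ℂ) → ℂ) : Prop :=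
  DifferentiableOn ℂ F (uPolydisc n) ∧ (∀ x ∈ uPolydisc n, ‖F x‖ ≤ 1) ∧
    ∀ j, F (z j) = lam j

/-- The `N`-point Pick problem on `𝔻ⁿ` is extremal: it is solvable, but not solvable
with supremum norm less than `1`. -/
def ExtremalPick (n N : ℕ) (z : Fin N → Fin n → ℂ) (lam : Fin N → ℂ) : Prop :=
  (∃ F, Interpolates n N z lam F) ∧
    ¬ ∃ F : (Fin n → ℂ) → ℂ, DifferentiableOn ℂ F (uPolydisc n) ∧
      (∃ r : ℝ, r < 1 ∧ ∀ x ∈ uPolydisc n, ‖F x‖ ≤ r) ∧ ∀ j, F (z j) = lam j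

/-- A three-point Pick problem is degenerate if one of its two-point subproblems
is extremal. -/
def DegeneratePick (n : ℕ) (z : Fin 3 → Fin n → ℂ) (lam : Fin 3 → ℂ) : Prop :=
  ∃ i j : Fin 3, i ≠ j ∧ ExtremalPick n 2 ![z i, z j] ![lam i, lam j]

/-- `F` depends only on the coordinates in `S`. -/
def DependsOnlyOn (n : ℕ) (S : Finset (Fin n)) (F : (Fin n → ℂ) → ℂ) : Prop :=
  ∀ x ∈ uPolydisc n, ∀ y ∈ uPolydisc n, (∀ i ∈ S, x i = y i) → F x = F y

/-- The Pick problem is `k`-dimensional: some interpolating function depends only on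
`k` of the coordinates. -/
def KDim (n N k : ℕ) (z : Fin N → Fin n → ℂ) (lam : Fin N → ℂ) : Prop :=
  ∃ S : Finset (Fin n), S.card ≤ k ∧ ∃ F, Interpolates n N z lam F ∧ DependsOnlyOn n S F

/-- The Poincaré (hyperbolic) distance on the unit disc. -/
def hypDist (a b : ℂ) : ℝ :=
  Real.log ((1 + ‖(a - b) / (1 - conj b * a)‖) / (1 - ‖(a - b) / (1 - conj b * a)‖))

/-- `φ` is a unimodular constant on the disc. -/
def IsUnimodConst (φ : ℂ → ℂ) : Prop := ∃ c : ℂ, ‖c‖ = 1 ∧ ∀ l ∈ uDisc, φ l = c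

/-- `φ` coincides on the disc with a holomorphic automorphism of the disc (a Möbius map). -/
def IsDiscAut (φ : ℂ → ℂ) : Prop :=
  ∃ c a : ℂ, ‖c‖ = 1 ∧ ‖a‖ < 1 ∧ ∀ l ∈ uDisc, φ l = c * mob a l

/-- The magic function `Φ_{s,η}`. -/
def PhiMagic (s : ℝ) (η z1 z2 : ℂ) : ℂ :=
  ((s:ℂ) * z1 + (1 - (s:ℂ)) * z2 - η * z1 * z2) /
    (1 - ((1 - (s:ℂ)) * z1 + (s:ℂ) * z2) * η)

/-- The rational function of formula (F), with `ω = (conj α1 − conj α2)/(α1 − α2)`. -/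
def magicF (t : ℝ) (η α1 α2 z1 z2 : ℂ) : ℂ :=
  ((t:ℂ) * z1 + conj η * (1 - (t:ℂ)) * z2 +
      ((conj α1 - conj α2) / (α1 - α2)) * conj η * z1 * z2) /
    (1 + (((1 - (t:ℂ)) * z1 + (t:ℂ) * conj η * z2) *
      ((conj α1 - conj α2) / (α1 - α2))))

/-- A function of two variables of the form (F). -/
def IsMagicForm (F : ℂ → ℂ → ℂ) : Prop :=
  ∃ t ∈ Ioo (0:ℝ) 1, ∃ η α1 α2 : ℂ, ‖η‖ = 1 ∧ ‖α1‖ < 1 ∧ ‖α2‖ < 1 ∧ α1 ≠ α2 ∧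
    ∀ z1 z2 : ℂ, ‖z1‖ < 1 → ‖z2‖ < 1 → F z1 z2 = magicF t η α1 α2 z1 z2

open Metric Topology Asymptotics

lemma aux_strict {E : Type*} [NormedAddCommGroup E] [NormedSpace ℂ E] (F : E → ℂ)
    (hd : DifferentiableOn ℂ F (ball 0 1)) (hb : ∀ x ∈ ball (0:E) 1, ‖F x‖ ≤ 1) :
    HasStrictFDerivAt F (fderiv ℂ F 0) 0 := by
  set L := fderiv ℂ F 0 with hL
  have hat : ∀ x ∈ ball (0:E) 1, DifferentiableAt ℂ F x := fun x hx =>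
    hd.differentiableAt (isOpen_ball.mem_nhds hx)
  have h0 : (0:E) ∈ ball (0:E) 1 := by simp
  set M : ℝ := 2 + ‖L‖ with hM
  have hM0 : 0 ≤ M := by positivity
  set G : E → ℂ := fun x => F x - F 0 - L x with hG
  have hG0 : G 0 = 0 := by simp [hG]
  have hGd : DifferentiableOn ℂ G (ball 0 1) :=
    (hd.sub_const _).sub L.differentiable.differentiableOn
  have hGm : MapsTo G (ball 0 1) (closedBall (G 0) M) := by
    intro x hx
    rw [hG0, mem_closedBall_zero_iff]
    have h1 := hb x hx
    have h2 := hb 0 h0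
    have h3 : ‖L x‖ ≤ ‖L‖ := by
      have := L.le_opNorm x
      have hx' : ‖x‖ < 1 := by simpa using hx
      nlinarith [norm_nonneg L, norm_nonneg x]
    calc ‖G x‖ ≤ ‖F x - F 0‖ + ‖L x‖ := norm_sub_le _ _
      _ ≤ (‖F x‖ + ‖F 0‖) + ‖L x‖ := by gcongr; exact norm_sub_le _ _
      _ ≤ M := by rw [hM]; linarith
  have hGo : (G · - G 0) =o[𝓝 0] (fun w : E ↦ ‖w - 0‖ ^ 1) := by
    have := (hat 0 h0).hasFDerivAt.isLittleO
    simp only [pow_one, isLittleO_norm_right]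
    simpa [hG0, hG] using this
  have hq : ∀ x ∈ ball (0:E) 1, ‖G x‖ ≤ M * ‖x‖ ^ 2 := by
    intro x hx
    have := Complex.dist_le_mul_div_pow_of_mapsTo_ball_of_isLittleO hGd hGm hGo hx
    simpa [hG0] using this
  have hfd : ∀ x ∈ ball (0:E) 1, fderiv ℂ F x = fderiv ℂ G x + L := by
    intro x hx
    have : HasFDerivAt G (fderiv ℂ F x - L) x :=
      ((hat x hx).hasFDerivAt.sub_const (F 0)).sub L.hasFDerivAt
    rw [this.fderiv]; simp
  have hbd : ∀ x ∈ ball (0:E) (1/2), ‖fderiv ℂ F x - L‖ ≤ 5 * M * ‖x‖ := by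
    intro x hx
    have hx' : ‖x‖ < 1/2 := by simpa using hx
    rcases eq_or_ne x 0 with rfl | hne
    · simp [hL]
    have hpos : 0 < ‖x‖ := norm_pos_iff.2 hne
    have hx1 : x ∈ ball (0:E) 1 := by simp; linarith
    rw [hfd x hx1, add_sub_cancel_right]
    have hsub : ball x ‖x‖ ⊆ ball (0:E) 1 := by
      intro y hy
      rw [mem_ball, dist_eq_norm] at hy
      have := norm_le_norm_add_norm_sub' y x
      simp; linarith
    have := Complex.norm_fderiv_le_div_of_mapsTo_ball (R₂ := 5 * M * ‖x‖ ^ 2) (hGd.mono hsub) (by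
      intro y hy
      have hy1 := hsub hy
      rw [mem_ball, dist_eq_norm] at hy
      have hn := norm_le_norm_add_norm_sub' y x
      rw [mem_closedBall, dist_eq_norm]
      have h1 := hq y hy1
      have h2 := hq x hx1
      have h3 : ‖y‖ ^ 2 ≤ (2 * ‖x‖) ^ 2 := by gcongr; linarith
      have h4 := norm_sub_le (G y) (G x)
      nlinarith) hpos
    calc _ ≤ _ := this
      _ = _ := by field_simp
  refine hasStrictFDerivAt_of_hasFDerivAt_of_continuousAt (f' := fderiv ℂ F) ?_ ?_
  · filter_upwards [isOpen_ball.mem_nhds h0] with x hx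
    exact (hat x hx).hasFDerivAt
  · rw [ContinuousAt, tendsto_iff_norm_sub_tendsto_zero]
    refine squeeze_zero' (g := fun x => 5 * M * ‖x‖) (Filter.Eventually.of_forall fun _ => norm_nonneg _) ?_ ?_
    · filter_upwards [ball_mem_nhds (0:E) (by norm_num : (0:ℝ) < 1/2)] with x hx
      exact hbd x hx
    · have : Continuous (fun x : E => 5 * M * ‖x‖) := by fun_prop
      simpa using this.tendsto 0

def Jet (h : ℂ → ℂ) (a b : ℂ) : Prop :=
  (fun z => h z - a * z - b * z ^ 2) =o[𝓝 0] (fun z : ℂ => z ^ 2)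

lemma jet_of_mul (k : ℂ → ℂ) (b : ℂ) (hk : HasDerivAt k b 0) :
    Jet (fun z => z * k z) (k 0) b := by
  have h := hk.isLittleO
  have h2 := (isBigO_refl (fun z : ℂ => z) (𝓝 0)).mul_isLittleO h
  unfold Jet
  refine (h2.congr ?_ ?_)
  · intro z; simp; ring
  · intro z; simp; ring

lemma jet_deriv (h : ℂ → ℂ) (a b : ℂ) (h0 : h 0 = 0) (hj : Jet h a b) : HasDerivAt h a 0 := by
  rw [hasDerivAt_iff_isLittleO]
  have h1 : (fun z : ℂ => z ^ 2) =o[𝓝 0] (fun z : ℂ => z) := by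
    simpa using (isLittleO_pow_id (𝕜 := ℂ) (n := 2) (by norm_num))
  have h2 := (hj.trans h1).add ((h1.const_mul_left b))
  refine h2.congr ?_ ?_
  · intro z; simp [h0]; ring
  · intro z; simp

lemma jet_dslope (h : ℂ → ℂ) (a b : ℂ) (h0 : h 0 = 0) (hj : Jet h a b) :
    dslope h 0 0 = a ∧ HasDerivAt (dslope h 0) b 0 := by
  have ha : dslope h 0 0 = a := by rw [dslope_same]; exact (jet_deriv h a b h0 hj).deriv
  refine ⟨ha, ?_⟩
  rw [hasDerivAt_iff_isLittleO, ha, isLittleO_iff]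
  intro c hc
  filter_upwards [(isLittleO_iff.1 hj) hc] with z hz
  rcases eq_or_ne z 0 with rfl | hne
  · rw [ha]; simp
  rw [dslope_of_ne _ hne, slope_def_field]
  have : (h z - h 0) / (z - 0) - a - (z - 0) • b = (h z - a * z - b * z ^ 2) / z := by
    simp [h0]; field_simp
  rw [this, norm_div, div_le_iff₀ (norm_pos_iff.2 hne)]
  calc _ ≤ _ := hz
    _ = _ := by rw [norm_pow]; simp; ring

lemma mob_den (a z : ℂ) (ha : ‖a‖ < 1) (hz : ‖z‖ ≤ 1) : 1 - conj a * z ≠ 0 := by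
  intro h
  have h1 : conj a * z = 1 := (sub_eq_zero.1 h).symm
  have h2 : ‖a‖ * ‖z‖ = 1 := by
    rw [← Complex.norm_conj a, ← norm_mul, h1, norm_one]
  nlinarith [norm_nonneg a, norm_nonneg z]

lemma mob_ident (a z : ℂ) :
    ‖1 - conj a * z‖ ^ 2 - ‖a - z‖ ^ 2 = (1 - ‖a‖ ^ 2) * (1 - ‖z‖ ^ 2) := by
  simp only [← Complex.normSq_eq_norm_sq, Complex.normSq_apply]
  simp
  ring

lemma mob_le (a z : ℂ) (ha : ‖a‖ < 1) (hz : ‖z‖ ≤ 1) : ‖mob a z‖ ≤ 1 := by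
  have hd := norm_pos_iff.2 (mob_den a z ha hz)
  rw [mob, norm_div, div_le_one hd]
  have := mob_ident a z
  have h1 : 0 ≤ (1 - ‖a‖ ^ 2) * (1 - ‖z‖ ^ 2) := by
    apply mul_nonneg <;> nlinarith [norm_nonneg a, norm_nonneg z]
  exact le_of_sq_le_sq (by linarith) hd.le

lemma mob_deriv (a z : ℂ) (hz : 1 - conj a * z ≠ 0) :
    HasDerivAt (mob a) (-(1 - (‖a‖:ℂ) ^ 2) / (1 - conj a * z) ^ 2) z := by
  have h1 : HasDerivAt (fun l => a - l) (-1) z := (hasDerivAt_id z).const_sub a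
  have h2 : HasDerivAt (fun l => 1 - conj a * l) (-(conj a * 1)) z :=
    ((hasDerivAt_id z).const_mul (conj a)).const_sub 1
  have h3 := h1.div h2 hz
  have e : -(1 - (‖a‖:ℂ) ^ 2) / (1 - conj a * z) ^ 2 =
      ((-1) * (1 - conj a * z) - (a - z) * (-(conj a * 1))) / (1 - conj a * z) ^ 2 := by
    rw [← Complex.mul_conj']; ring
  rw [e]; exact h3

lemma schwarz_aux1 (h : ℂ → ℂ) (a b : ℂ) (ha : ‖a‖ < 1) (hd : DifferentiableOn ℂ h (ball 0 1))
    (hm : ∀ z ∈ ball (0:ℂ) 1, ‖h z‖ ≤ 1) (h0 : h 0 = 0) (hj : Jet h a b) :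
    ‖b‖ ≤ 1 - ‖a‖ ^ 2 ∧
    (b = -(1 - (‖a‖:ℂ) ^ 2) → ∀ z ∈ ball (0:ℂ) 1, h z = z * mob a z) := by
  obtain ⟨hk0, hkd⟩ := jet_dslope h a b h0 hj
  set k := dslope h 0 with hk
  have hz0 : (0:ℂ) ∈ ball (0:ℂ) 1 := by simp
  have hkdiff : DifferentiableOn ℂ k (ball 0 1) :=
    (Complex.differentiableOn_dslope (isOpen_ball.mem_nhds hz0)).2 hd
  have hmaps : MapsTo h (ball 0 1) (closedBall (h 0) 1) := by
    intro z hz; simpa [h0] using hm z hz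
  have hk1 : ∀ z ∈ ball (0:ℂ) 1, ‖k z‖ ≤ 1 := by
    intro z hz
    simpa using Complex.norm_dslope_le_div_of_mapsTo_ball hd hmaps hz
  have hpos : 0 < 1 - ‖a‖ ^ 2 := by nlinarith [norm_nonneg a]
  have hposC : (1 - (‖a‖:ℂ) ^ 2) ≠ 0 := by exact_mod_cast hpos.ne'
  set w : ℂ → ℂ := fun z => mob a (k z) with hw
  have hw0 : w 0 = 0 := by simp [hw, hk0, mob]
  have hwd : DifferentiableOn ℂ w (ball 0 1) := by
    intro z hz
    exact ((mob_deriv a (k z) (mob_den a _ ha (hk1 z hz))).differentiableAt).comp_differentiableWithinAt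
      z (hkdiff z hz)
  have hwm : MapsTo w (ball 0 1) (closedBall (w 0) 1) := by
    intro z hz
    rw [hw0, mem_closedBall_zero_iff]
    exact mob_le a _ ha (hk1 z hz)
  have hden : 1 - conj a * a = 1 - (‖a‖:ℂ) ^ 2 := by rw [← Complex.mul_conj']; ring
  have hwder : HasDerivAt w (-b / (1 - (‖a‖:ℂ) ^ 2)) 0 := by
    have h1 := mob_deriv a (k 0) (mob_den a _ ha (hk1 0 hz0))
    have h2 := h1.comp (0:ℂ) hkd
    rw [hk0, hden] at h2
    have e : -b / (1 - (‖a‖:ℂ) ^ 2) = -(1 - (‖a‖:ℂ) ^ 2) / (1 - (‖a‖:ℂ) ^ 2) ^ 2 * b := by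
      rw [div_mul_eq_mul_div, div_eq_div_iff hposC (pow_ne_zero 2 hposC)]; ring
    rw [e]
    exact h2
  constructor
  · have := Complex.norm_deriv_le_one_of_mapsTo_ball hwd hwm one_pos
    rw [hwder.deriv, norm_div, norm_neg] at this
    have e : ‖1 - (‖a‖:ℂ) ^ 2‖ = 1 - ‖a‖ ^ 2 := by
      have : (1 - (‖a‖:ℂ) ^ 2) = ((1 - ‖a‖ ^ 2 : ℝ) : ℂ) := by push_cast; rfl
      rw [this, Complex.norm_real, Real.norm_of_nonneg hpos.le]
    rw [e, div_le_one hpos] at this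
    exact this
  · intro hb z hz
    have hder1 : deriv w 0 = 1 := by
      rw [hwder.deriv, hb, neg_neg, div_self hposC]
    have haff := Complex.affine_of_mapsTo_ball_of_norm_dslope_eq_div hwd hwm hz0
      (by rw [dslope_same, hder1]; simp)
    have hwz : w z = z := by
      have := haff hz
      simpa [hw0, dslope_same, hder1] using this
    have hkz : k z = mob a z := by
      have hz' : ‖z‖ ≤ 1 := by simpa using (mem_ball.1 hz).le
      have d1 := mob_den a (k z) ha (hk1 z hz)
      have d2 := mob_den a z ha hz'
      have : (a - k z) / (1 - conj a * k z) = z := hwz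
      rw [div_eq_iff d1] at this
      rw [mob, eq_div_iff d2]
      linear_combination -this
    rw [← hkz]
    have := sub_smul_dslope h 0 z
    simpa [h0] using this.symm

lemma jet_unique (h g : ℂ → ℂ) (a b a' b' : ℂ) (h0 : h 0 = 0) (hg : h =ᶠ[𝓝 0] g)
    (hj : Jet h a b) (hj' : Jet g a' b') : a = a' ∧ b = b' := by
  have hj2 : Jet h a' b' := by
    refine IsLittleO.congr' hj' ?_ Filter.EventuallyEq.rfl
    filter_upwards [hg] with z hz
    rw [hz]
  obtain ⟨h1, h2⟩ := jet_dslope h a b h0 hj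
  obtain ⟨h3, h4⟩ := jet_dslope h a' b' h0 hj2
  exact ⟨h1.symm.trans h3, h2.unique h4⟩

lemma polydisc_eq : uPolydisc 3 = ball (0 : Fin 3 → ℂ) 1 := by
  ext x
  simp [uPolydisc, pi_norm_lt_iff]

lemma curve_mem (c k : Fin 3 → ℂ) (hc : ∀ i, ‖c i‖ < 1) (hk : ∀ i, ‖k i‖ = 1) (z : ℂ)
    (hz : ‖z‖ < 1) : (fun i => z * mob (c i) (k i * z)) ∈ ball (0 : Fin 3 → ℂ) 1 := by
  rw [← polydisc_eq]
  intro i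
  have := mob_le (c i) (k i * z) (hc i) (by rw [norm_mul, hk i, one_mul]; exact hz.le)
  rw [norm_mul]
  nlinarith [norm_nonneg z, norm_nonneg (mob (c i) (k i * z))]

lemma curve_deriv (c k z : ℂ) (hc : ‖c‖ < 1) (hk : ‖k‖ = 1) (hz : ‖z‖ < 1) :
    HasDerivAt (fun z => mob c (k * z)) (-(1 - (‖c‖:ℂ) ^ 2) / (1 - conj c * (k * z)) ^ 2 * k) z := by
  have h1 := mob_deriv c (k * z) (mob_den c _ hc (by rw [norm_mul, hk, one_mul]; exact hz.le))
  have h2 : HasDerivAt (fun z => k * z) k z := by simpa using (hasDerivAt_id z).const_mul k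
  exact h1.comp z h2

lemma jetA (G : (Fin 3 → ℂ) → ℂ) (hd : DifferentiableOn ℂ G (ball 0 1))
    (hm : ∀ x ∈ ball (0 : Fin 3 → ℂ) 1, ‖G x‖ ≤ 1) (h0 : G 0 = 0) (α : Fin 3 → ℂ)
    (hα : ∀ i, ‖α i‖ < 1) :
    ∃ q : ℂ, ∀ (s : ℂ) (k : Fin 3 → ℂ), (∀ i, ‖k i‖ = 1) → (∀ i, ‖s * α i‖ < 1) →
      Jet (fun z => G (fun i => z * mob (s * α i) (k i * z))) (s * fderiv ℂ G 0 α)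
        (s ^ 2 * q + fderiv ℂ G 0 (fun i => -(k i * (1 - (‖s * α i‖:ℂ) ^ 2)))) := by
  have hst := aux_strict G hd hm
  set L := fderiv ℂ G 0 with hL
  set f : ℂ → ℂ := fun z => G (z • α) with hf
  have hz0 : (0:ℂ) ∈ ball (0:ℂ) 1 := by simp
  have hαb : ‖α‖ < 1 := (pi_norm_lt_iff one_pos).2 hα
  have hfd : DifferentiableOn ℂ f (ball 0 1) := by
    refine hd.comp (by fun_prop) ?_
    intro z hz
    rw [mem_ball_zero_iff] at hz ⊢
    rw [norm_smul]
    nlinarith [norm_nonneg z, norm_nonneg α]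
  have hkd : DifferentiableOn ℂ (dslope f 0) (ball 0 1) :=
    (Complex.differentiableOn_dslope (isOpen_ball.mem_nhds hz0)).2 hfd
  have hf0 : f 0 = 0 := by simp [hf, h0]
  have hfL : HasDerivAt f (L α) 0 := by
    have h1 : HasDerivAt (fun z : ℂ => z • α) α 0 := by
      simpa using (hasDerivAt_id (0:ℂ)).smul_const α
    have h2 : HasFDerivAt G L ((0:ℂ) • α) := by simpa using hst.hasFDerivAt
    exact h2.comp_hasDerivAt (0:ℂ) h1
  set q := deriv (dslope f 0) 0 with hq
  have hjf : Jet f (L α) q := by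
    have := jet_of_mul (dslope f 0) q
      (hkd.differentiableAt (isOpen_ball.mem_nhds hz0)).hasDerivAt
    rw [dslope_same, hfL.deriv] at this
    convert this using 1
    ext z
    have := sub_smul_dslope f 0 z
    simpa [hf0] using this.symm
  refine ⟨q, fun s k hk hs => ?_⟩
  -- the curve
  set ψ : ℂ → Fin 3 → ℂ := fun z i => z * mob (s * α i) (k i * z) with hψ
  set v : Fin 3 → ℂ := fun i => -(k i * (1 - (‖s * α i‖:ℂ) ^ 2)) with hv
  have hjψ : ∀ i, Jet (fun z => ψ z i) (s * α i) (v i) := by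
    intro i
    have h1 := curve_deriv (s * α i) (k i) 0 (hs i) (hk i) (by simp)
    have h2 := jet_of_mul _ _ h1
    convert h2 using 1
    · simp [mob]
    · simp [hv]; ring
  have hψ1 : (fun z => ψ z - (s * z) • α - z ^ 2 • v) =o[𝓝 0] (fun z : ℂ => z ^ 2) := by
    rw [isLittleO_pi]
    intro i
    refine (hjψ i).congr_left ?_
    intro z; simp; ring
  have hψ2 : (fun z => ψ z - (s * z) • α) =O[𝓝 0] (fun z : ℂ => z ^ 2) := by
    have h1 : (fun z : ℂ => z ^ 2 • v) =O[𝓝 0] (fun z : ℂ => z ^ 2) := by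
      refine IsBigO.of_bound ‖v‖ (Filter.Eventually.of_forall fun z => ?_)
      rw [norm_smul, mul_comm]
    refine (hψ1.isBigO.add h1).congr_left ?_
    intro z; simp
  have ht : Filter.Tendsto (fun z : ℂ => (ψ z, (s * z) • α)) (𝓝 0) (𝓝 (0, 0)) := by
    have c2 : ContinuousAt (fun z : ℂ => (s * z) • α) 0 := by fun_prop
    have c1 : ContinuousAt ψ 0 := by
      rw [continuousAt_pi]
      intro i
      exact continuousAt_id.mul (curve_deriv (s * α i) (k i) 0 (hs i) (hk i) (by simp)).continuousAt
    have c3 := c1.prodMk c2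
    have e : (ψ 0, (s * 0) • α) = ((0, 0) : (Fin 3 → ℂ) × (Fin 3 → ℂ)) := by
      ext i <;> simp [hψ]
    rw [ContinuousAt, e] at c3
    exact c3
  have hs1 : (fun z => G (ψ z) - f (s * z) - L (ψ z - (s * z) • α)) =o[𝓝 0] (fun z : ℂ => z ^ 2) := by
    have := hst.isLittleO.comp_tendsto ht
    exact IsLittleO.trans_isBigO this hψ2
  have hs2 : (fun z => L (ψ z - (s * z) • α - z ^ 2 • v)) =o[𝓝 0] (fun z : ℂ => z ^ 2) :=
    (L.isBigO_comp _ _).trans_isLittleO hψ1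
  have hs3 : (fun z => f (s * z) - L α * (s * z) - q * (s * z) ^ 2) =o[𝓝 0] (fun z : ℂ => z ^ 2) := by
    have ht2 : Filter.Tendsto (fun z : ℂ => s * z) (𝓝 0) (𝓝 0) := by
      have : Continuous (fun z : ℂ => s * z) := by fun_prop
      simpa using this.tendsto 0
    have h1 := IsLittleO.comp_tendsto hjf ht2
    refine h1.trans_isBigO ?_
    refine IsBigO.of_bound (‖s‖ ^ 2) (Filter.Eventually.of_forall fun z => ?_)
    simp [mul_pow]
  refine ((hs1.add hs2).add hs3).congr_left ?_
  intro z
  simp only [map_sub, map_smul, smul_eq_mul]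
  ring

lemma phase (d θ : ℂ) (hθ : ‖θ‖ = 1) : ∃ k : ℂ, ‖k‖ = 1 ∧ k * d = ‖d‖ * θ := by
  rcases eq_or_ne d 0 with rfl | hd
  · exact ⟨1, by simp, by simp⟩
  · have : (‖d‖ : ℂ) ≠ 0 := by simpa using hd
    refine ⟨‖d‖ * θ / d, ?_, by field_simp⟩
    have : ‖d‖ ≠ 0 := by simpa using hd
    simp [hθ, this]

lemma coreB (G : (Fin 3 → ℂ) → ℂ) (hd : DifferentiableOn ℂ G (ball 0 1))
    (hm : ∀ x ∈ ball (0 : Fin 3 → ℂ) 1, ‖G x‖ ≤ 1) (h0 : G 0 = 0) (α : Fin 3 → ℂ) (γ : ℂ)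
    (hα : ∀ i, ‖α i‖ < 1) (hγ : ‖γ‖ < 1)
    (hleft : ∀ z ∈ ball (0:ℂ) 1, G (fun i => z * mob (α i) z) = z * mob γ z) :
    ∃ τ : Fin 3 → ℝ, (∀ i, 0 ≤ τ i) ∧ ∑ i, τ i = 1 ∧ γ = ∑ i, (τ i : ℂ) * α i ∧
      ∀ t ∈ Icc (0:ℝ) 1, ∀ z ∈ ball (0:ℂ) 1,
        G (fun i => z * mob (t * α i) z) = z * mob (t * γ) z := by
  obtain ⟨q, hq⟩ := jetA G hd hm h0 α hα
  set L := fderiv ℂ G 0 with hL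
  set d : Fin 3 → ℂ := fun i => L (Pi.single i 1) with hdd
  have hLs : ∀ x : Fin 3 → ℂ, L x = ∑ i, x i * d i := by
    intro x
    have h1 : x = ∑ i, x i • (Pi.single i 1 : Fin 3 → ℂ) := (pi_eq_sum_univ' x)
    conv_lhs => rw [h1]
    simp [map_sum, hdd]
  have hcd : ∀ (c k : Fin 3 → ℂ), (∀ i, ‖c i‖ < 1) → (∀ i, ‖k i‖ = 1) →
      DifferentiableOn ℂ (fun z => G (fun i => z * mob (c i) (k i * z))) (ball 0 1) := by
    intro c k hc hk
    refine hd.comp ?_ ?_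
    · rw [differentiableOn_pi]
      intro i z hz
      have := curve_deriv (c i) (k i) z (hc i) (hk i) (by simpa using hz)
      exact (differentiableAt_id.mul this.differentiableAt).differentiableWithinAt
    · intro z hz
      exact curve_mem c k hc hk z (by simpa using hz)
  have hc0 : ∀ (c k : Fin 3 → ℂ), G (fun i => (0:ℂ) * mob (c i) (k i * 0)) = 0 := by
    intro c k
    simp only [zero_mul]; exact h0
  have hS : ∀ (s : ℂ) (k : Fin 3 → ℂ), (∀ i, ‖k i‖ = 1) → (∀ i, ‖s * α i‖ < 1) →
      ‖s * L α‖ < 1 → _ := fun s k hk hs ha =>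
    schwarz_aux1 _ _ _ ha (hcd (fun i => s * α i) k hs hk)
      (fun z hz => hm _ (curve_mem (fun i => s * α i) k hs hk z (by simpa using hz)))
      (hc0 _ _) (hq s k hk hs)
  -- original disc
  have horig := hq 1 (fun _ => 1) (by simp) (by simpa using hα)
  have hγj : Jet (fun z => z * mob γ z) γ (-(1 - (‖γ‖:ℂ) ^ 2)) := by
    have h1 := jet_of_mul _ _ (mob_deriv γ 0 (by simp))
    convert h1 using 1
    · simp [mob]
    · simp
  obtain ⟨hγL, hqγ⟩ := jet_unique _ _ _ _ _ _ (hc0 _ _) (by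
    filter_upwards [ball_mem_nhds (0:ℂ) one_pos] with z hz
    simpa using hleft z hz) horig hγj
  rw [one_mul] at hγL
  have hq' : q = ∑ i, (1 - (‖α i‖:ℂ) ^ 2) * d i - (1 - (‖γ‖:ℂ) ^ 2) := by
    rw [hLs] at hqγ
    simp only [one_pow, one_mul, neg_mul, Finset.sum_neg_distrib] at hqγ
    linear_combination hqγ
  -- key inequality
  have key : ∀ s : ℝ, 0 ≤ s → (∀ i, s * ‖α i‖ < 1) → s * ‖γ‖ < 1 →
      s ^ 2 * ‖q‖ + ∑ i, (1 - s ^ 2 * ‖α i‖ ^ 2) * ‖d i‖ ≤ 1 - s ^ 2 * ‖γ‖ ^ 2 := by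
    intro s hs0 hsα hsγ
    obtain ⟨θ, hθ, hθq⟩ : ∃ θ : ℂ, ‖θ‖ = 1 ∧ q = ‖q‖ * θ := by
      obtain ⟨κ, h1, h2⟩ := phase q 1 (by simp)
      have hκ : κ ≠ 0 := by rintro rfl; simp at h1
      refine ⟨κ⁻¹, by simp [h1], ?_⟩
      rw [mul_one] at h2
      rw [← h2]; field_simp
    choose k hk hkd using fun i => phase (d i) (-θ) (by simpa using hθ)
    have hn : ∀ x : ℂ, ‖(s:ℂ) * x‖ = s * ‖x‖ := by
      intro x; rw [norm_mul, Complex.norm_real, Real.norm_of_nonneg hs0]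
    have h1 := (hS s k hk (by intro i; rw [hn]; exact hsα i) (by rw [hγL, hn]; exact hsγ)).1
    rw [hLs, hγL, hn] at h1
    have e : (s:ℂ) ^ 2 * q + ∑ i, -(k i * (1 - (‖(s:ℂ) * α i‖:ℂ) ^ 2)) * d i =
        ((s ^ 2 * ‖q‖ + ∑ i, (1 - s ^ 2 * ‖α i‖ ^ 2) * ‖d i‖ : ℝ) : ℂ) * θ := by
      simp only [hn]
      push_cast
      rw [add_mul, Finset.sum_mul]
      congr 1
      · conv_lhs => rw [hθq]
        ring
      · refine Finset.sum_congr rfl fun i _ => ?_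
        linear_combination (-(1 - ((s:ℂ) * ‖α i‖) ^ 2)) * hkd i
    rw [e, norm_mul, hθ, mul_one, Complex.norm_real] at h1
    calc _ ≤ _ := le_abs_self _
      _ ≤ _ := h1
      _ = _ := by ring
  -- choose s
  have hsum1 : ∑ i, ‖d i‖ ≤ 1 := by simpa using key 0 le_rfl (by simp) (by simp)
  obtain ⟨s, hs1, hsα, hsγ⟩ : ∃ s : ℝ, 1 < s ∧ (∀ i, s * ‖α i‖ < 1) ∧ s * ‖γ‖ < 1 := by
    have hαb : ‖α‖ < 1 := (pi_norm_lt_iff one_pos).2 hα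
    set m := max ‖α‖ ‖γ‖ with hmm
    have hm1 : m < 1 := max_lt hαb hγ
    have hm0 : 0 ≤ m := (norm_nonneg α).trans (le_max_left _ _)
    have hlt : ∀ x, x ≤ m → 2 / (1 + m) * x < 1 := by
      intro x hx
      rw [div_mul_eq_mul_div, div_lt_one (by linarith)]
      linarith
    refine ⟨2 / (1 + m), ?_, ?_, ?_⟩
    · rw [one_lt_div (by linarith)]; linarith
    · intro i
      exact hlt _ ((norm_le_pi_norm α i).trans (le_max_left _ _))
    · exact hlt _ (le_max_right _ _)
  have hk := key s (by linarith) hsα hsγ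
  have hqre : (1 - ‖γ‖ ^ 2) - ∑ i, (1 - ‖α i‖ ^ 2) * (d i).re ≤ ‖q‖ := by
    have h1 : -q.re ≤ ‖q‖ := (neg_le_abs _).trans (Complex.abs_re_le_norm q)
    have h2 : q = ((∑ i, ((1 - ‖α i‖ ^ 2 : ℝ) : ℂ) * d i) - ((1 - ‖γ‖ ^ 2 : ℝ) : ℂ)) := by
      rw [hq']; push_cast; rfl
    have h3 : q.re = ∑ i, (1 - ‖α i‖ ^ 2) * (d i).re - (1 - ‖γ‖ ^ 2) := by
      rw [h2, Complex.sub_re, Complex.re_sum, Complex.ofReal_re]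
      simp only [Complex.re_ofReal_mul]
    linarith
  have hre : ∀ i, (d i).re ≤ ‖d i‖ := fun i => Complex.re_le_norm _
  have hαp : ∀ i, 0 < 1 - ‖α i‖ ^ 2 := fun i => by nlinarith [hα i, norm_nonneg (α i)]
  have hS1 : 1 < s ^ 2 := by nlinarith
  have hpr : ∀ i, 0 ≤ (1 - ‖α i‖ ^ 2) * (‖d i‖ - (d i).re) := fun i =>
    mul_nonneg (hαp i).le (sub_nonneg.2 (hre i))
  simp only [Fin.sum_univ_three] at hk hqre hsum1
  have hcomb : s ^ 2 * ((1 - ‖α 0‖ ^ 2) * (‖d 0‖ - (d 0).re) + (1 - ‖α 1‖ ^ 2) * (‖d 1‖ - (d 1).re)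
      + (1 - ‖α 2‖ ^ 2) * (‖d 2‖ - (d 2).re)) ≤ (s ^ 2 - 1) * (‖d 0‖ + ‖d 1‖ + ‖d 2‖ - 1) := by
    nlinarith [mul_le_mul_of_nonneg_left hqre (by positivity : (0:ℝ) ≤ s ^ 2)]
  have hP : 0 ≤ (1 - ‖α 0‖ ^ 2) * (‖d 0‖ - (d 0).re) + (1 - ‖α 1‖ ^ 2) * (‖d 1‖ - (d 1).re)
      + (1 - ‖α 2‖ ^ 2) * (‖d 2‖ - (d 2).re) := by linarith [hpr 0, hpr 1, hpr 2]
  have hsumeq : ‖d 0‖ + ‖d 1‖ + ‖d 2‖ = 1 := by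
    have : 0 ≤ (s ^ 2 - 1) * (‖d 0‖ + ‖d 1‖ + ‖d 2‖ - 1) := le_trans (by positivity) hcomb
    have := nonneg_of_mul_nonneg_right this (by linarith : 0 < s ^ 2 - 1)
    linarith
  have hP0 : (1 - ‖α 0‖ ^ 2) * (‖d 0‖ - (d 0).re) + (1 - ‖α 1‖ ^ 2) * (‖d 1‖ - (d 1).re)
      + (1 - ‖α 2‖ ^ 2) * (‖d 2‖ - (d 2).re) ≤ 0 := by
    rw [hsumeq, sub_self, mul_zero] at hcomb
    by_contra hcon
    push Not at hcon
    have := mul_pos (by linarith : 0 < s ^ 2) hcon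
    linarith
  have hzero : ∀ i, (1 - ‖α i‖ ^ 2) * (‖d i‖ - (d i).re) = 0 := by
    intro i
    have a0 := hpr 0
    have a1 := hpr 1
    have a2 := hpr 2
    fin_cases i <;> simp only [Fin.zero_eta, Fin.mk_one, Fin.reduceFinMk] <;> linarith
  have hdi : ∀ i, d i = (‖d i‖ : ℂ) := by
    intro i
    have h1 : (d i).re = ‖d i‖ := by
      rcases mul_eq_zero.1 (hzero i) with h | h
      · exact absurd h (hαp i).ne'
      · linarith
    have h2 := Complex.sq_norm (d i)
    rw [Complex.normSq_apply, h1] at h2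
    have h3 : (d i).im = 0 := by
      have : (d i).im * (d i).im = 0 := by linarith [sq ‖d i‖]
      simpa using this
    exact Complex.ext (by simpa using h1) (by simpa using h3)
  have hsC : (∑ i, d i) = 1 := by
    rw [Fin.sum_univ_three, hdi 0, hdi 1, hdi 2]
    exact_mod_cast hsumeq
  refine ⟨fun i => ‖d i‖, fun i => norm_nonneg _, by rw [Fin.sum_univ_three]; exact hsumeq, ?_, ?_⟩
  · rw [← hγL, hLs]
    refine Finset.sum_congr rfl fun i _ => ?_
    rw [← hdi i]; ring
  · intro t ht z hz
    have hn : ∀ x : ℂ, ‖(t:ℂ) * x‖ = t * ‖x‖ := by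
      intro x; rw [norm_mul, Complex.norm_real, Real.norm_of_nonneg ht.1]
    have hlt : ∀ x : ℂ, ‖x‖ < 1 → ‖(t:ℂ) * x‖ < 1 := by
      intro x hx; rw [hn]; nlinarith [ht.1, ht.2, norm_nonneg x]
    have h1 := (hS t (fun _ => 1) (by simp) (fun i => hlt _ (hα i))
      (by rw [hγL]; exact hlt _ hγ)).2 ?_ z hz
    · simpa [hγL] using h1
    · rw [hLs, hγL, hq']
      simp only [hn, Fin.sum_univ_three]
      rw [Fin.sum_univ_three] at hsC
      push_cast
      linear_combination (-1 + (t:ℂ) ^ 2) * hsC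

/-- if a holomorphic `F : 𝔻³ → 𝔻` is a left inverse of the disc
`λ ↦ (λ m_{α1}(λ), ω1 λ m_{α2}(λ), ω2 λ m_{α3}(λ))` with composition `λ m_γ(λ)`, then `γ`
is a convex combination of `α1, α2, α3`, and the analogous identity holds for the
scaled discs for every `t ∈ [0,1]`. -/
theorem statement_8 (α1 α2 α3 ω1 ω2 γ : ℂ)
    (hα1 : ‖α1‖ < 1) (hα2 : ‖α2‖ < 1) (hα3 : ‖α3‖ < 1)
    (hω1 : ‖ω1‖ = 1) (hω2 : ‖ω2‖ = 1) (hγ : ‖γ‖ < 1)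
    (F : (Fin 3 → ℂ) → ℂ)
    (hFd : DifferentiableOn ℂ F (uPolydisc 3))
    (hFm : ∀ x ∈ uPolydisc 3, ‖F x‖ < 1)
    (hleft : ∀ l ∈ uDisc,
      F ![l * mob α1 l, ω1 * (l * mob α2 l), ω2 * (l * mob α3 l)] = l * mob γ l) :
    (∃ t1 t2 t3 : ℝ, 0 ≤ t1 ∧ 0 ≤ t2 ∧ 0 ≤ t3 ∧ t1 + t2 + t3 = 1 ∧
      γ = (t1:ℂ) * α1 + (t2:ℂ) * α2 + (t3:ℂ) * α3) ∧
    ∀ t ∈ Icc (0:ℝ) 1, ∀ l ∈ uDisc,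
      F ![l * mob ((t:ℂ) * α1) l, ω1 * (l * mob ((t:ℂ) * α2) l),
          ω2 * (l * mob ((t:ℂ) * α3) l)] = l * mob ((t:ℂ) * γ) l := by
  have hD : uDisc = ball (0:ℂ) 1 := by ext z; simp [uDisc]
  rw [polydisc_eq] at hFd hFm
  rw [hD] at hleft ⊢
  set w : Fin 3 → ℂ := ![1, ω1, ω2] with hw
  set α : Fin 3 → ℂ := ![α1, α2, α3] with hα
  have hwn : ∀ i, ‖w i‖ = 1 := by
    intro i; fin_cases i <;> simp [hw, hω1, hω2]
  have hαn : ∀ i, ‖α i‖ < 1 := by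
    intro i; fin_cases i <;> simp [hα, hα1, hα2, hα3]
  set G : (Fin 3 → ℂ) → ℂ := fun x => F (fun i => w i * x i) with hG
  have hmem : ∀ x ∈ ball (0 : Fin 3 → ℂ) 1, (fun i => w i * x i) ∈ ball (0 : Fin 3 → ℂ) 1 := by
    intro x hx
    rw [← polydisc_eq] at hx ⊢
    intro i
    rw [norm_mul, hwn i, one_mul]
    exact hx i
  have hGd : DifferentiableOn ℂ G (ball 0 1) := hFd.comp (by fun_prop) hmem
  have hGF : ∀ β1 β2 β3 z : ℂ, G (fun i => z * mob (![β1, β2, β3] i) z) =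
      F ![z * mob β1 z, ω1 * (z * mob β2 z), ω2 * (z * mob β3 z)] := by
    intro β1 β2 β3 z
    simp only [hG]
    congr 1
    ext i
    fin_cases i <;> simp [hw]
  have hGl : ∀ z ∈ ball (0:ℂ) 1, G (fun i => z * mob (α i) z) = z * mob γ z := by
    intro z hz
    rw [hα, hGF]
    exact hleft z hz
  have hG0 : G 0 = 0 := by
    have := hGl 0 (by simp)
    simp only [zero_mul] at this
    exact this
  obtain ⟨τ, h1, h2, h3, h4⟩ := coreB G hGd (fun x hx => (hFm _ (hmem x hx)).le) hG0 α γ hαn hγ hGl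
  rw [Fin.sum_univ_three] at h2 h3
  refine ⟨⟨τ 0, τ 1, τ 2, h1 0, h1 1, h1 2, h2, by simpa [hα] using h3⟩, ?_⟩
  intro t ht z hz
  have h5 := h4 t ht z hz
  rw [← h5, ← hGF]
  congr 1
  ext i
  fin_cases i <;> simp [hα]
end
end

section
/- Let α_1, α_2, α_3 ∈ 𝔻 be not co-linear and let γ lie in the open triangle with vertices α_1, α_2, α_3 (i.e. γ = t_1·α_1 + t_2·α_2 + t_3·α_3 with t_1, t_2, t_3 > 0 and t_1 + t_2 + t_3 = 1). Then there exist two distinct holomorphic functions F, G : 𝔻³ → 𝔻 such that F(λ·m_{α_1}(λ), λ·m_{α_2}(λ), λ·m_{α_3}(λ)) = G(λ·m_{α_1}(λ), λ·m_{α_2}(λ), λ·m_{α_3}(λ)) = λ·m_γ(λ) for all λ ∈ 𝔻; that is, a left inverse to the disc λ ↦ (λ·m_{α_1}(λ), λ·m_{α_2}(λ), λ·m_{α_3}(λ)) with prescribed composition λ·m_γ(λ) is never unique. -/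
open Complex Set ComplexConjugate

noncomputable section

def mag (t : ℝ) (w z1 z2 : ℂ) : ℂ :=
  ((t:ℂ) * z1 + (1 - (t:ℂ)) * z2 + w * z1 * z2) /
    (1 + w * ((1 - (t:ℂ)) * z1 + (t:ℂ) * z2))

lemma conv_lt (t : ℝ) (h0 : 0 < t) (h1 : t < 1) (z1 z2 : ℂ) (hz1 : ‖z1‖ < 1) (hz2 : ‖z2‖ < 1) :
    ‖(t:ℂ) * z1 + (1 - (t:ℂ)) * z2‖ < 1 := by
  have h := norm_add_le ((t:ℂ) * z1) ((1 - (t:ℂ)) * z2)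
  have e : (1 - (t:ℂ)) = ((1 - t : ℝ) : ℂ) := by push_cast; ring
  rw [e] at h ⊢
  rw [norm_mul, norm_mul, Complex.norm_real, Complex.norm_real, Real.norm_of_nonneg h0.le,
    Real.norm_of_nonneg (by linarith : 0 ≤ 1 - t)] at h
  nlinarith

lemma one_add_ne (u : ℂ) (h : ‖u‖ < 1) : 1 + u ≠ 0 := by
  intro h0
  have : u = -1 := by linear_combination h0
  rw [this] at h
  simp at h

lemma mag_den (t : ℝ) (h0 : 0 < t) (h1 : t < 1) (w z1 z2 : ℂ) (hw : ‖w‖ = 1)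
    (hz1 : ‖z1‖ < 1) (hz2 : ‖z2‖ < 1) :
    1 + w * ((1 - (t:ℂ)) * z1 + (t:ℂ) * z2) ≠ 0 := by
  apply one_add_ne
  rw [norm_mul, hw, one_mul, add_comm]
  exact conv_lt t h0 h1 z2 z1 hz2 hz1

lemma nsq (z : ℂ) : ‖z‖ ^ 2 = z.re ^ 2 + z.im ^ 2 := by
  rw [Complex.sq_norm, Complex.normSq_apply]; ring

lemma key_pos (t : ℝ) (h0 : 0 < t) (h1 : t < 1) (x y : ℂ) (hx : ‖x‖ < 1) (hy : ‖y‖ < 1) :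
    ‖(t:ℂ) * x + (1 - (t:ℂ)) * y - x * y‖ < ‖1 - ((1 - (t:ℂ)) * x + (t:ℂ) * y)‖ := by
  apply lt_of_pow_lt_pow_left₀ 2 (norm_nonneg _)
  have hx2 : ‖x‖ ^ 2 < 1 := by nlinarith [norm_nonneg x]
  have hy2 : ‖y‖ ^ 2 < 1 := by nlinarith [norm_nonneg y]
  have hA : 0 < ‖1 - x‖ ^ 2 := by
    have := one_add_ne (-x) (by simpa using hx)
    rw [← sub_eq_add_neg] at this
    positivity
  have hB : 0 < ‖1 - y‖ ^ 2 := by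
    have := one_add_ne (-y) (by simpa using hy)
    rw [← sub_eq_add_neg] at this
    positivity
  have p1 := mul_pos (mul_pos h0 (sub_pos.2 hx2)) hB
  have p2 := mul_pos (mul_pos (sub_pos.2 h1) (sub_pos.2 hy2)) hA
  rw [nsq] at *
  rw [nsq] at *
  simp only [nsq, add_re, sub_re, mul_re, one_re, ofReal_re, ofReal_im, add_im, sub_im, mul_im,
    one_im] at *
  nlinarith

lemma mag_lt (t : ℝ) (h0 : 0 < t) (h1 : t < 1) (w z1 z2 : ℂ) (hw : ‖w‖ = 1)
    (hz1 : ‖z1‖ < 1) (hz2 : ‖z2‖ < 1) : ‖mag t w z1 z2‖ < 1 := by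
  have hd := mag_den t h0 h1 w z1 z2 hw hz1 hz2
  have h := key_pos t h0 h1 (-w * z1) (-w * z2) (by simpa [hw] using hz1) (by simpa [hw] using hz2)
  rw [mag, norm_div, div_lt_one (norm_pos_iff.2 hd)]
  have e1 : (t:ℂ) * (-w * z1) + (1 - (t:ℂ)) * (-w * z2) - (-w * z1) * (-w * z2)
      = -w * ((t:ℂ) * z1 + (1 - (t:ℂ)) * z2 + w * z1 * z2) := by ring
  have e2 : 1 - ((1 - (t:ℂ)) * (-w * z1) + (t:ℂ) * (-w * z2))
      = 1 + w * ((1 - (t:ℂ)) * z1 + (t:ℂ) * z2) := by ring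
  rw [e1, e2, norm_mul, norm_neg, hw, one_mul] at h
  exact h

lemma mag_diff (t : ℝ) (h0 : 0 < t) (h1 : t < 1) (w : ℂ) (hw : ‖w‖ = 1)
    (f g : (Fin 3 → ℂ) → ℂ) (hf : DifferentiableOn ℂ f (uPolydisc 3))
    (hg : DifferentiableOn ℂ g (uPolydisc 3)) (hf1 : ∀ x ∈ uPolydisc 3, ‖f x‖ < 1)
    (hg1 : ∀ x ∈ uPolydisc 3, ‖g x‖ < 1) :
    DifferentiableOn ℂ (fun x => mag t w (f x) (g x)) (uPolydisc 3) := by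
  unfold mag
  simp only [div_eq_mul_inv]
  have hn : DifferentiableOn ℂ (fun x => (t:ℂ) * f x + (1 - (t:ℂ)) * g x + w * f x * g x)
    (uPolydisc 3) := by fun_prop
  have hd : DifferentiableOn ℂ (fun x => 1 + w * ((1 - (t:ℂ)) * f x + (t:ℂ) * g x))
    (uPolydisc 3) := by fun_prop
  exact hn.mul (hd.inv fun x hx => mag_den t h0 h1 w _ _ hw (hf1 x hx) (hg1 x hx))

lemma den_ne (a l : ℂ) (ha : ‖a‖ < 1) (hl : ‖l‖ < 1) : 1 - conj a * l ≠ 0 := by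
  rw [sub_eq_add_neg]
  apply one_add_ne
  rw [norm_neg, norm_mul, RCLike.norm_conj]
  nlinarith [norm_nonneg a, norm_nonneg l]

lemma lmob_lt (a l : ℂ) (ha : ‖a‖ < 1) (hl : ‖l‖ < 1) : ‖l * mob a l‖ < 1 := by
  have h1 : ‖mob a l‖ ≤ 1 := by
    rw [mob, norm_div]
    apply div_le_one_of_le₀ _ (norm_nonneg _)
    apply le_of_sq_le_sq _ (norm_nonneg _)
    have hx2 : ‖a‖ ^ 2 < 1 := by nlinarith [norm_nonneg a]
    have hy2 : ‖l‖ ^ 2 < 1 := by nlinarith [norm_nonneg l]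
    have p := mul_pos (sub_pos.2 hx2) (sub_pos.2 hy2)
    simp only [nsq, add_re, sub_re, mul_re, one_re, ofReal_re, ofReal_im, add_im, sub_im, mul_im,
      one_im, conj_re, conj_im] at *
    nlinarith
  rw [norm_mul]
  nlinarith [norm_nonneg l, norm_nonneg (mob a l)]

lemma mag_mob (t : ℝ) (h0 : 0 < t) (h1 : t < 1) (w a b l : ℂ) (hw : ‖w‖ = 1)
    (hwe : w * (a - b) = conj a - conj b)
    (ha : ‖a‖ < 1) (hb : ‖b‖ < 1) (hl : ‖l‖ < 1) :
    mag t w (l * mob a l) (l * mob b l) = l * mob ((t:ℂ) * a + (1 - (t:ℂ)) * b) l := by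
  have hd := mag_den t h0 h1 w _ _ hw (lmob_lt a l ha hl) (lmob_lt b l hb hl)
  have hg := den_ne _ l (conv_lt t h0 h1 a b ha hb) hl
  have hA := den_ne a l ha hl
  have hB := den_ne b l hb hl
  rw [mag, div_eq_iff hd]
  have hx : l * mob a l * (1 - conj a * l) = l * (a - l) := by
    rw [mob, mul_assoc, div_mul_cancel₀ _ hA]
  have hy : l * mob b l * (1 - conj b * l) = l * (b - l) := by
    rw [mob, mul_assoc, div_mul_cancel₀ _ hB]
  have hz : l * mob ((t:ℂ) * a + (1 - (t:ℂ)) * b) l *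
      (1 - conj ((t:ℂ) * a + (1 - (t:ℂ)) * b) * l) = l * ((t:ℂ) * a + (1 - (t:ℂ)) * b - l) := by
    rw [mob, mul_assoc, div_mul_cancel₀ _ hg]
  simp only [map_add, map_mul, map_sub, map_one, conj_ofReal] at hz hg
  generalize l * mob a l = x at *
  generalize l * mob b l = y at *
  generalize l * mob ((t:ℂ) * a + (1 - (t:ℂ)) * b) l = z at *
  generalize conj a = A at *
  generalize conj b = B at *
  obtain ⟨E, hE⟩ : ∃ E, E = 1 - ((t:ℂ) * A + (1 - (t:ℂ)) * B) * l := ⟨_, rfl⟩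
  apply mul_left_cancel₀ (mul_ne_zero (mul_ne_zero hA hB) hg)
  rw [← hE] at hz ⊢
  have e1 : (1 - A * l) * (1 - B * l) * E * ((t:ℂ) * x + (1 - (t:ℂ)) * y + w * x * y)
      = ((t:ℂ) * (x * (1 - A * l)) * (1 - B * l) + (1 - (t:ℂ)) * (y * (1 - B * l)) * (1 - A * l)
        + w * (x * (1 - A * l)) * (y * (1 - B * l))) * E := by ring
  have e2 : (1 - A * l) * (1 - B * l) * E * (z * (1 + w * ((1 - (t:ℂ)) * x + (t:ℂ) * y)))
      = (z * E) * ((1 - A * l) * (1 - B * l) + w * ((1 - (t:ℂ)) * (x * (1 - A * l)) * (1 - B * l)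
        + (t:ℂ) * (y * (1 - B * l)) * (1 - A * l))) := by ring
  rw [e1, e2, hx, hy, hz, hE]
  linear_combination (l ^ 2 * t * (1 - t) * ((b - l) * (1 - A * l) - (a - l) * (1 - B * l))) * hwe

lemma strict (a b : ℝ) (ha : 0 < a) (hb : 0 < b) (u v w : ℂ) (hu : ‖u‖ = 1) (hv : ‖v‖ = 1)
    (hw : ‖w‖ = 1) (h : (a:ℂ) * u + (b:ℂ) * v = ((a + b : ℝ) : ℂ) * w) : u = v := by
  have hu2 := nsq u
  have hv2 := nsq v
  have hw2 := nsq w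
  rw [hu] at hu2
  rw [hv] at hv2
  rw [hw] at hw2
  have hr := congrArg Complex.re h
  have hi := congrArg Complex.im h
  simp at hr hi
  have e : 2 * (a * b) * ((u.re - v.re) ^ 2 + (u.im - v.im) ^ 2) = 0 := by
    linear_combination (-2 * a * b - 2 * a ^ 2) * hu2 + (-2 * a * b - 2 * b ^ 2) * hv2
      + 2 * (a + b) ^ 2 * hw2 - 2 * (a * u.re + b * v.re + (a + b) * w.re) * hr
      - 2 * (a * u.im + b * v.im + (a + b) * w.im) * hi
  have e2 : (u.re - v.re) ^ 2 + (u.im - v.im) ^ 2 = 0 := by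
    rcases mul_eq_zero.1 e with h | h
    · exfalso; have := mul_pos ha hb; linarith
    · exact h
  apply Complex.ext <;> nlinarith [sq_nonneg (u.re - v.re), sq_nonneg (u.im - v.im)]

lemma det_ne (a b c : ℂ) (h : ¬ Collinear ℝ ({a, b, c} : Set ℂ)) :
    (a.re - b.re) * (b.im - c.im) - (a.im - b.im) * (b.re - c.re) ≠ 0 := by
  intro h0
  apply h
  by_cases hab : a = b
  · subst hab
    simpa using collinear_pair ℝ a c
  have hn : (a.re - b.re) ^ 2 + (a.im - b.im) ^ 2 ≠ 0 := by
    intro h1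
    apply hab
    apply Complex.ext <;> nlinarith [sq_nonneg (a.re - b.re), sq_nonneg (a.im - b.im)]
  rw [collinear_iff_of_mem (p₀ := b) (by simp)]
  refine ⟨a - b, ?_⟩
  intro p hp
  simp only [mem_insert_iff, mem_singleton_iff] at hp
  rcases hp with rfl | rfl | rfl
  · exact ⟨1, by simp⟩
  · exact ⟨0, by simp⟩
  · obtain ⟨r, hr⟩ : ∃ r : ℝ, r * ((a.re - b.re) ^ 2 + (a.im - b.im) ^ 2) =
        (p.re - b.re) * (a.re - b.re) + (p.im - b.im) * (a.im - b.im) :=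
      ⟨_, div_mul_cancel₀ _ hn⟩
    refine ⟨r, ?_⟩
    apply Complex.ext
    · simp
      apply mul_left_cancel₀ hn
      linear_combination (a.im - b.im) * h0 - (a.re - b.re) * hr
    · simp
      apply mul_left_cancel₀ hn
      linear_combination (-(a.re - b.re)) * h0 - (a.im - b.im) * hr

lemma om (a b : ℂ) (h : a ≠ b) : ∃ w : ℂ, ‖w‖ = 1 ∧ w * (a - b) = conj a - conj b := by
  have h' : a - b ≠ 0 := sub_ne_zero.2 h
  refine ⟨(conj a - conj b) / (a - b), ?_, by field_simp⟩
  rw [← map_sub, norm_div, RCLike.norm_conj, div_self (norm_ne_zero_iff.2 h')]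

lemma om_eq (w p q : ℂ) (hp : w * p = conj p) (hq : w * q = conj q) :
    p.re * q.im - p.im * q.re = 0 := by
  have h : conj p * q = p * conj q := by rw [← hp, ← hq]; ring
  have := congrArg Complex.im h
  simp at this
  linarith

/-- for non-co-linear `α1, α2, α3` and `γ` in the open triangle spanned by
them, a left inverse to `λ ↦ (λ m_{α1}(λ), λ m_{α2}(λ), λ m_{α3}(λ))` with prescribed
composition `λ m_γ(λ)` is never unique. -/
theorem statement_9 (α1 α2 α3 : ℂ)
    (hα1 : ‖α1‖ < 1) (hα2 : ‖α2‖ < 1) (hα3 : ‖α3‖ < 1)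
    (hcol : ¬ Collinear ℝ ({α1, α2, α3} : Set ℂ))
    (t1 t2 t3 : ℝ) (ht1 : 0 < t1) (ht2 : 0 < t2) (ht3 : 0 < t3)
    (hsum : t1 + t2 + t3 = 1)
    (γ : ℂ) (hγ : γ = (t1:ℂ) * α1 + (t2:ℂ) * α2 + (t3:ℂ) * α3) :
    ∃ F G : (Fin 3 → ℂ) → ℂ,
      DifferentiableOn ℂ F (uPolydisc 3) ∧ DifferentiableOn ℂ G (uPolydisc 3) ∧
      (∀ x ∈ uPolydisc 3, ‖F x‖ < 1) ∧ (∀ x ∈ uPolydisc 3, ‖G x‖ < 1) ∧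
      (∀ l ∈ uDisc, F ![l * mob α1 l, l * mob α2 l, l * mob α3 l] = l * mob γ l) ∧
      (∀ l ∈ uDisc, G ![l * mob α1 l, l * mob α2 l, l * mob α3 l] = l * mob γ l) ∧
      ∃ x ∈ uPolydisc 3, F x ≠ G x := by
  have D := det_ne _ _ _ hcol
  have hs : 0 < t1 + t2 := by linarith
  have hr : 0 < t2 + t3 := by linarith
  have hs1 : t1 + t2 < 1 := by linarith
  have ht11 : t1 < 1 := by linarith
  obtain ⟨t, ht⟩ : ∃ t, t = t1 / (t1 + t2) := ⟨_, rfl⟩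
  obtain ⟨u, hu⟩ : ∃ u, u = t2 / (t2 + t3) := ⟨_, rfl⟩
  have t0 : 0 < t := by rw [ht]; positivity
  have t1' : t < 1 := by rw [ht, div_lt_one hs]; linarith
  have u0 : 0 < u := by rw [hu]; positivity
  have u1' : u < 1 := by rw [hu, div_lt_one hr]; linarith
  have hts : t * (t1 + t2) = t1 := by rw [ht]; field_simp
  have hur : u * (t2 + t3) = t2 := by rw [hu]; field_simp
  have htsC : (t:ℂ) * ((t1:ℂ) + t2) = t1 := by exact_mod_cast hts
  have hurC : (u:ℂ) * ((t2:ℂ) + t3) = t2 := by exact_mod_cast hur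
  have hsumC : (t1:ℂ) + t2 + t3 = 1 := by exact_mod_cast hsum
  obtain ⟨δ, hδ⟩ : ∃ δ, δ = (t:ℂ) * α1 + (1 - (t:ℂ)) * α2 := ⟨_, rfl⟩
  obtain ⟨ε, hε⟩ : ∃ ε, ε = (u:ℂ) * α2 + (1 - (u:ℂ)) * α3 := ⟨_, rfl⟩
  have nδ : ‖δ‖ < 1 := by rw [hδ]; exact conv_lt t t0 t1' _ _ hα1 hα2
  have nε : ‖ε‖ < 1 := by rw [hε]; exact conv_lt u u0 u1' _ _ hα2 hα3
  have δre : δ.re = t * α1.re + (1 - t) * α2.re := by rw [hδ]; simp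
  have δim : δ.im = t * α1.im + (1 - t) * α2.im := by rw [hδ]; simp
  have εre : ε.re = u * α2.re + (1 - u) * α3.re := by rw [hε]; simp
  have εim : ε.im = u * α2.im + (1 - u) * α3.im := by rw [hε]; simp
  have n12 : α1 ≠ α2 := by rintro rfl; apply D; ring
  have n23 : α2 ≠ α3 := by rintro rfl; apply D; ring
  have nδ3 : δ ≠ α3 := by
    intro h; apply D
    rw [← h, δre, δim]; ring
  have n1ε : α1 ≠ ε := by
    intro h; apply D
    rw [h, εre, εim]; ring
  obtain ⟨w12, hw12, ew12⟩ := om _ _ n12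
  obtain ⟨w23, hw23, ew23⟩ := om _ _ n23
  obtain ⟨wd, hwd, ewd⟩ := om _ _ nδ3
  obtain ⟨we, hwe, ewe⟩ := om _ _ n1ε
  have c0 : DifferentiableOn ℂ (fun x : Fin 3 → ℂ => x 0) (uPolydisc 3) := by fun_prop
  have c1 : DifferentiableOn ℂ (fun x : Fin 3 → ℂ => x 1) (uPolydisc 3) := by fun_prop
  have c2 : DifferentiableOn ℂ (fun x : Fin 3 → ℂ => x 2) (uPolydisc 3) := by fun_prop
  have b0 : ∀ x ∈ uPolydisc 3, ‖x 0‖ < 1 := fun x hx => hx 0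
  have b1 : ∀ x ∈ uPolydisc 3, ‖x 1‖ < 1 := fun x hx => hx 1
  have b2 : ∀ x ∈ uPolydisc 3, ‖x 2‖ < 1 := fun x hx => hx 2
  have B12 : ∀ x ∈ uPolydisc 3, ‖mag t w12 (x 0) (x 1)‖ < 1 := fun x hx =>
    mag_lt t t0 t1' w12 _ _ hw12 (b0 x hx) (b1 x hx)
  have B23 : ∀ x ∈ uPolydisc 3, ‖mag u w23 (x 1) (x 2)‖ < 1 := fun x hx =>
    mag_lt u u0 u1' w23 _ _ hw23 (b1 x hx) (b2 x hx)
  refine ⟨fun x => mag (t1 + t2) wd (mag t w12 (x 0) (x 1)) (x 2),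
    fun x => mag t1 we (x 0) (mag u w23 (x 1) (x 2)), ?_, ?_, ?_, ?_, ?_, ?_, ?_⟩
  · exact mag_diff _ hs hs1 wd hwd _ _ (mag_diff t t0 t1' w12 hw12 _ _ c0 c1 b0 b1) c2 B12 b2
  · exact mag_diff _ ht1 ht11 we hwe _ _ c0 (mag_diff u u0 u1' w23 hw23 _ _ c1 c2 b1 b2) b0 B23
  · exact fun x hx => mag_lt _ hs hs1 wd _ _ hwd (B12 x hx) (b2 x hx)
  · exact fun x hx => mag_lt _ ht1 ht11 we _ _ hwe (b0 x hx) (B23 x hx)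
  · intro l hl
    have e : γ = ((t1 + t2 : ℝ) : ℂ) * δ + (1 - ((t1 + t2 : ℝ) : ℂ)) * α3 := by
      rw [hγ, hδ]; push_cast
      linear_combination (α2 - α1) * htsC + α3 * hsumC
    simp only [Matrix.cons_val]
    rw [mag_mob t t0 t1' w12 _ _ l hw12 ew12 hα1 hα2 hl, ← hδ,
      mag_mob _ hs hs1 wd _ _ l hwd ewd nδ hα3 hl, ← e]
  · intro l hl
    have e : γ = (t1 : ℂ) * α1 + (1 - (t1 : ℂ)) * ε := by
      rw [hγ, hε]
      linear_combination (α3 - α2) * hurC + (u * (α2 - α3) + α3) * hsumC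
    simp only [Matrix.cons_val]
    rw [mag_mob u u0 u1' w23 _ _ l hw23 ew23 hα2 hα3 hl, ← hε,
      mag_mob _ ht1 ht11 we _ _ l hwe ewe hα1 nε hl, ← e]
  · refine ⟨![1/2, 0, 0], ?_, ?_⟩
    · intro i; fin_cases i <;> simp <;> norm_num
    · intro h
      simp only [Matrix.cons_val] at h
      have d1 := mag_den t t0 t1' w12 (1/2) 0 hw12 (by norm_num) (by norm_num)
      have d2 := mag_den _ hs hs1 wd (mag t w12 (1/2) 0) 0 hwd
        (mag_lt t t0 t1' w12 (1/2) 0 hw12 (by norm_num) (by norm_num)) (by norm_num)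
      have d3 := mag_den t1 ht1 ht11 we (1/2) 0 hwe (by norm_num) (by norm_num)
      have z : mag u w23 0 0 = 0 := by simp [mag]
      rw [z] at h
      have ht1C : (t1:ℂ) ≠ 0 := by exact_mod_cast ht1.ne'
      have hsC : (t1:ℂ) + t2 ≠ 0 := by exact_mod_cast hs.ne'
      have q : mag t w12 (1/2) 0 * (1 + w12 * ((1 - (t:ℂ)) * (1/2))) = (t:ℂ) * (1/2) := by
        simp only [mul_zero, add_zero] at d1
        simp only [mag, mul_zero, add_zero]
        exact div_mul_cancel₀ _ d1
      generalize mag t w12 (1/2) 0 = Q at *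
      rw [mag, mag, div_eq_div_iff d2 d3] at h
      push_cast at h
      have key : (t1:ℂ) * ((t2:ℂ) * w12 + ((t3 * t1 : ℝ):ℂ) * wd) =
          (t1:ℂ) * (((t2 + t3 * t1 : ℝ) : ℂ) * we) := by
        push_cast
        have k1 : (1 + w12 * ((1 - (t:ℂ)) * (1/2))) * (((t1:ℂ) + t2) * Q *
            (1 + we * ((1 - (t1:ℂ)) * (1/2)))) = (1 + w12 * ((1 - (t:ℂ)) * (1/2))) *
            ((t1:ℂ) * (1/2) * (1 + wd * ((1 - ((t1:ℂ) + t2)) * Q))) := by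
          linear_combination (1 + w12 * ((1 - (t:ℂ)) * (1/2))) * h
        have k2 : (t1:ℂ) * (1 + we * ((1 - (t1:ℂ)) * (1/2))) = (t1:ℂ) *
            ((1 + w12 * ((1 - (t:ℂ)) * (1/2))) + wd * ((1 - ((t1:ℂ) + t2)) * ((t:ℂ) * (1/2)))) := by
          linear_combination 2 * k1 - 2 * (((t1:ℂ) + t2) * (1 + we * ((1 - (t1:ℂ)) * (1/2)))
            - (t1:ℂ) * (1/2) * wd * (1 - ((t1:ℂ) + t2))) * q
            - (1 + we * ((1 - (t1:ℂ)) * (1/2))) * htsC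
        have k3 := mul_left_cancel₀ ht1C k2
        have h3 : (t3:ℂ) = 1 - (t1 + t2) := by linear_combination hsumC
        rw [h3]
        linear_combination (-2 * (t1:ℂ) * (t1 + t2)) * k3
          + (t1:ℂ) * (w12 - wd * (1 - ((t1:ℂ) + t2))) * htsC
      have key2 := mul_left_cancel₀ ht1C key
      have hEq := strict t2 (t3 * t1) ht2 (by positivity) _ _ _ hw12 hwd hwe key2
      rw [hEq] at ew12
      rw [← map_sub] at ew12 ewd
      have := om_eq wd _ _ ew12 ewd
      apply D
      simp only [sub_re, sub_im, δre, δim] at this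
      linear_combination this
end
end

section
/- Let s ∈ (0,1), η ∈ 𝕋, and let φ, ψ : 𝔻 → 𝔻 be holomorphic. If the function λ ↦ Φ_{s,η}(λ·φ(λ), λ·ψ(λ)) is a Blaschke product of degree 2, then both φ and ψ are Möbius maps, i.e. holomorphic automorphisms of 𝔻. -/
open Complex Set ComplexConjugate

noncomputable section

lemma aux_compact_bound (K : Set ℂ) (hK : IsCompact K) (k q : ℂ → ℝ) (hk : ContinuousOn k K)
    (hq : ContinuousOn q K) (hq0 : ∀ x ∈ K, 0 ≤ q x) (hz : ∀ x ∈ K, q x = 0 → k x = 0)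
    (ε : ℝ) (hε : 0 < ε) : ∃ C : ℝ, 0 ≤ C ∧ ∀ x ∈ K, |k x| ≤ ε + C * q x := by
  obtain ⟨M, hM⟩ := hK.exists_bound_of_continuousOn hk
  have hS : IsCompact (K ∩ (fun x => |k x|) ⁻¹' Ici ε) := by
    have : IsClosed (K ∩ (fun x => |k x|) ⁻¹' Ici ε) :=
      (hk.abs).preimage_isClosed_of_isClosed hK.isClosed isClosed_Ici
    exact hK.of_isClosed_subset this inter_subset_left
  rcases (K ∩ (fun x => |k x|) ⁻¹' Ici ε).eq_empty_or_nonempty with he | hne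
  · refine ⟨0, le_rfl, fun x hx => ?_⟩
    by_contra hcon
    have : x ∈ (K ∩ (fun x => |k x|) ⁻¹' Ici ε) := ⟨hx, by simp at hcon ⊢; linarith⟩
    rw [he] at this
    exact this
  · obtain ⟨y, hy, hmin⟩ := hS.exists_isMinOn hne (hq.mono inter_subset_left)
    have hqy : 0 < q y := by
      rcases (hq0 y hy.1).lt_or_eq with h | h
      · exact h
      · have h1 := hz y hy.1 h.symm
        have h2 : ε ≤ |k y| := hy.2
        rw [h1, abs_zero] at h2
        linarith
    have hM0 : 0 ≤ M := (norm_nonneg _).trans (hM y hy.1)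
    refine ⟨M / q y, by positivity, fun x hx => ?_⟩
    by_cases hxe : ε ≤ |k x|
    · have h1 : q y ≤ q x := hmin ⟨hx, hxe⟩
      have h2 : M ≤ M / q y * q x := by
        rw [div_mul_eq_mul_div, le_div_iff₀ hqy]
        exact mul_le_mul_of_nonneg_left h1 hM0
      have := hM x hx
      rw [Real.norm_eq_abs] at this
      linarith
    · have : 0 ≤ M / q y * q x := mul_nonneg (by positivity) (hq0 x hx)
      linarith

lemma aux_avg_le (u k q : ℂ → ℝ) (hu : ContinuousOn u (Metric.sphere 0 1))
    (hk : ContinuousOn k (Metric.sphere 0 1)) 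
    (hu0 : ∀ x ∈ Metric.sphere (0:ℂ) 1, 0 ≤ u x) (hu1 : Real.circleAverage u 0 1 = 1)
    (ε C δ : ℝ) (hC : 0 ≤ C) (hkb : ∀ x ∈ Metric.sphere (0:ℂ) 1, |k x| ≤ ε + C * q x)
    (hqu : ∀ x ∈ Metric.sphere (0:ℂ) 1, q x * u x ≤ δ) :
    |Real.circleAverage (fun x => k x * u x) 0 1| ≤ ε + C * δ := by
  have hui : CircleIntegrable u 0 1 := hu.circleIntegrable zero_le_one
  refine Real.abs_circleAverage_le_circleAverage_abs.trans ?_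
  have h1 : Real.circleAverage (|fun x => k x * u x|) 0 1 ≤
      Real.circleAverage (fun x => ε • u x + C * δ) 0 1 := by
    apply Real.circleAverage_mono
    · exact ((hk.mul hu).abs).circleIntegrable zero_le_one
    · exact ((hu.const_smul ε).add continuousOn_const).circleIntegrable zero_le_one
    · intro x hx
      rw [abs_one] at hx
      simp only [Pi.abs_apply, abs_mul, abs_of_nonneg (hu0 x hx), smul_eq_mul]
      calc |k x| * u x ≤ (ε + C * q x) * u x :=
            mul_le_mul_of_nonneg_right (hkb x hx) (hu0 x hx)
        _ = ε * u x + C * (q x * u x) := by ring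
        _ ≤ _ := by have := mul_le_mul_of_nonneg_left (hqu x hx) hC; linarith
  refine h1.trans ?_
  rw [Real.circleAverage_fun_add (show CircleIntegrable (fun x => ε • u x) 0 1 from
      (hu.const_smul ε).circleIntegrable zero_le_one)
    (circleIntegrable_const _ _ _), Real.circleAverage_fun_smul, hu1, Real.circleAverage_const]
  simp

lemma aux_herglotz (F : ℂ → ℂ) (hF : DifferentiableOn ℂ F (Metric.ball 0 1)) (h0 : F 0 = 1)
    (hpos : ∀ z ∈ Metric.ball (0:ℂ) 1, 0 ≤ (F z).re) (ζ₁ ζ₂ : ℂ) (h1 : ‖ζ₁‖ = 1) (h2 : ‖ζ₂‖ = 1)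
    (hne : ζ₁ ≠ ζ₂) (C : ℝ)
    (hb : ∀ z ∈ Metric.ball (0:ℂ) 1, ‖z - ζ₁‖ ^ 2 * ‖z - ζ₂‖ ^ 2 * (F z).re ≤ C * (1 - ‖z‖ ^ 2)) :
    ∃ t₁ t₂ : ℝ, 0 ≤ t₁ ∧ 0 ≤ t₂ ∧ t₁ + t₂ = 1 ∧ ∀ z ∈ Metric.ball (0:ℂ) 1,
      F z = t₁ * ((ζ₁ + z) / (ζ₁ - z)) + t₂ * ((ζ₂ + z) / (ζ₂ - z)) := by
  classical
  have hζ : 0 < ‖ζ₁ - ζ₂‖ ^ 2 := by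
    have := norm_pos_iff.mpr (sub_ne_zero.mpr hne); positivity
  set r : ℕ → ℝ := fun n => 1 - 1 / ((n:ℝ) + 1) with hr
  have hr0 : ∀ n, 0 ≤ r n := fun n => by
    have : 1 / ((n:ℝ) + 1) ≤ 1 := by rw [div_le_one (by positivity)]; linarith [n.cast_nonneg (α := ℝ)]
    simp only [hr]; linarith
  have hr1 : ∀ n, r n < 1 := fun n => by
    have : 0 < 1 / ((n:ℝ) + 1) := by positivity
    simp only [hr]; linarith
  have hrt : Filter.Tendsto r Filter.atTop (nhds 1) := by
    have := (tendsto_one_div_add_atTop_nhds_zero_nat (𝕜 := ℝ)).const_sub 1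
    rw [sub_zero] at this
    exact this
  set v : ℕ → ℂ → ℝ := fun n z => (F ((r n : ℂ) * z)).re with hv
  have hmem : ∀ n, ∀ z : ℂ, ‖z‖ ≤ 1 → (r n : ℂ) * z ∈ Metric.ball (0:ℂ) 1 := fun n z hz => by
    rw [mem_ball_zero_iff, norm_mul, Complex.norm_real, Real.norm_of_nonneg (hr0 n)]
    nlinarith [hr0 n, hr1 n, norm_nonneg z]
  have hFa : AnalyticOnNhd ℂ F (Metric.ball 0 1) := hF.analyticOnNhd Metric.isOpen_ball
  have hvh : ∀ n, InnerProductSpace.HarmonicOnNhd (v n) (Metric.closedBall 0 1) := fun n z hz => by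
    have hz' : ‖z‖ ≤ 1 := by simpa using hz
    have : AnalyticAt ℂ (fun z => F ((r n : ℂ) * z)) z :=
      (hFa _ (hmem n z hz')).fun_comp (analyticAt_const.mul analyticAt_id)
    exact this.harmonicAt_re
  have hvc : ∀ n, ContinuousOn (v n) (Metric.sphere 0 1) := fun n => by
    intro z hz
    have hz' : ‖z‖ ≤ 1 := by simp at hz; exact hz.le
    have : AnalyticAt ℂ (fun z => F ((r n : ℂ) * z)) z :=
      (hFa _ (hmem n z hz')).fun_comp (analyticAt_const.mul analyticAt_id)
    exact (Complex.continuous_re.continuousAt.comp this.continuousAt).continuousWithinAt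
  have hv0 : ∀ n, ∀ x ∈ Metric.sphere (0:ℂ) 1, 0 ≤ v n x := fun n x hx =>
    hpos _ (hmem n x (by simp at hx; exact hx.le))
  have hv1 : ∀ n, Real.circleAverage (v n) 0 1 = 1 := fun n => by
    have := (hvh n)
    rw [show (1:ℝ) = |1| by simp] at this
    rw [this.circleAverage_eq]
    simp [hv, h0]
  set q : ℂ → ℝ := fun x => ‖x - ζ₁‖ ^ 2 * ‖x - ζ₂‖ ^ 2 with hqdef
  have hqc : Continuous q := by fun_prop
  have hqv : ∀ n, ∀ x ∈ Metric.sphere (0:ℂ) 1, q x * v n x ≤ 16 * (C * (1 - r n ^ 2)) := by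
    intro n x hx
    have hx1 : ‖x‖ = 1 := by simpa using hx
    have hnx : ‖(r n : ℂ) * x‖ = r n := by
      rw [norm_mul, Complex.norm_real, Real.norm_of_nonneg (hr0 n), hx1, mul_one]
    have key : ∀ ζ : ℂ, ‖ζ‖ = 1 → ‖x - ζ‖ ^ 2 ≤ 4 * ‖(r n : ℂ) * x - ζ‖ ^ 2 := by
      intro ζ hζ1
      have e1 : ‖x - (r n : ℂ) * x‖ = 1 - r n := by
        rw [show x - (r n : ℂ) * x = ((1 - r n : ℝ) : ℂ) * x by push_cast; ring, norm_mul,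
          Complex.norm_real, hx1, Real.norm_of_nonneg (by linarith [hr1 n]), mul_one]
      have e2 : 1 - r n ≤ ‖(r n : ℂ) * x - ζ‖ := by
        have := norm_sub_norm_le ζ ((r n : ℂ) * x)
        rw [hζ1, hnx, norm_sub_rev] at this
        exact this
      have e3 : ‖x - ζ‖ ≤ ‖x - (r n : ℂ) * x‖ + ‖(r n : ℂ) * x - ζ‖ := norm_sub_le_norm_sub_add_norm_sub _ _ _
      have e4 : ‖x - ζ‖ ≤ 2 * ‖(r n : ℂ) * x - ζ‖ := by linarith
      calc ‖x - ζ‖ ^ 2 ≤ (2 * ‖(r n : ℂ) * x - ζ‖) ^ 2 := by gcongr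
        _ = _ := by ring
    have hb' := hb _ (hmem n x hx1.le)
    rw [hnx] at hb'
    calc q x * v n x ≤ ((4 * ‖(r n : ℂ) * x - ζ₁‖ ^ 2) * (4 * ‖(r n : ℂ) * x - ζ₂‖ ^ 2)) * v n x := by
          apply mul_le_mul_of_nonneg_right _ (hv0 n x hx)
          exact mul_le_mul (key _ h1) (key _ h2) (by positivity) (by positivity)
      _ = 16 * (‖(r n : ℂ) * x - ζ₁‖ ^ 2 * ‖(r n : ℂ) * x - ζ₂‖ ^ 2 * v n x) := by ring
      _ ≤ _ := by gcongr
  set l₁ : ℂ → ℝ := fun x => ‖x - ζ₂‖ ^ 2 / ‖ζ₁ - ζ₂‖ ^ 2 with hl₁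
  set l₂ : ℂ → ℝ := fun x => ‖x - ζ₁‖ ^ 2 / ‖ζ₁ - ζ₂‖ ^ 2 with hl₂
  have hl₁c : Continuous l₁ := by fun_prop
  have hl₂c : Continuous l₂ := by fun_prop
  have hS : ∀ ε > 0, ∀ k : ℂ → ℝ, ContinuousOn k (Metric.sphere 0 1) → k ζ₁ = 0 → k ζ₂ = 0 →
      ∀ᶠ n in Filter.atTop, |Real.circleAverage (fun x => k x * v n x) 0 1| ≤ ε := by
    intro ε hε k hk hk1 hk2
    obtain ⟨D, hD0, hD⟩ := aux_compact_bound _ (isCompact_sphere (0:ℂ) 1) k q hk hqc.continuousOn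
      (fun x _ => by positivity) (fun x _ hx => by
        simp only [hqdef, mul_eq_zero] at hx
        rcases hx with hx | hx
        · have : x = ζ₁ := by simpa [sub_eq_zero] using hx
          rw [this, hk1]
        · have : x = ζ₂ := by simpa [sub_eq_zero] using hx
          rw [this, hk2]) (ε / 2) (by positivity)
    have ht : Filter.Tendsto (fun n => D * (16 * (C * (1 - r n ^ 2)))) Filter.atTop (nhds 0) := by
      have := ((((hrt.pow 2).const_sub 1).const_mul C).const_mul 16).const_mul D
      simpa using this
    filter_upwards [ht.eventually_lt_const (half_pos hε)] with n hn
    have := aux_avg_le (v n) k q (hvc n) hk (hv0 n) (hv1 n) (ε / 2) D _ hD0 hD (hqv n)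
    linarith
  set T : ℕ → ℝ × ℝ := fun n => (Real.circleAverage (fun x => l₁ x * v n x) 0 1,
    Real.circleAverage (fun x => l₂ x * v n x) 0 1) with hT
  have hlb : ∀ l : ℂ → ℝ, ContinuousOn l (Metric.sphere 0 1) → (∀ x, 0 ≤ l x) → ∃ M, ∀ n,
      Real.circleAverage (fun x => l x * v n x) 0 1 ∈ Icc 0 M := by
    intro l hl hl0
    obtain ⟨M, hM⟩ := (isCompact_sphere (0:ℂ) 1).exists_bound_of_continuousOn hl
    refine ⟨M, fun n => ⟨?_, ?_⟩⟩
    · apply Real.circleAverage_nonneg_of_nonneg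
      intro x hx
      rw [abs_one] at hx
      exact mul_nonneg (hl0 x) (hv0 n x hx)
    · have := aux_avg_le (v n) l (fun _ => 0) (hvc n) hl (hv0 n) (hv1 n) M 0 0 le_rfl
        (fun x hx => by simpa using hM x hx) (by simp)
      simp at this
      exact (le_abs_self _).trans this
  obtain ⟨M₁, hM₁⟩ := hlb l₁ hl₁c.continuousOn (fun x => by positivity)
  obtain ⟨M₂, hM₂⟩ := hlb l₂ hl₂c.continuousOn (fun x => by positivity)
  obtain ⟨⟨t₁, t₂⟩, htm, g, hg, hgt⟩ := (isCompact_Icc.prod isCompact_Icc).tendsto_subseq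
    (x := T) (fun n => mem_prod.mpr ⟨hM₁ n, hM₂ n⟩)
  have hT1 : Filter.Tendsto (fun n => (T (g n)).1) Filter.atTop (nhds t₁) :=
    (continuous_fst.tendsto _).comp hgt
  have hT2 : Filter.Tendsto (fun n => (T (g n)).2) Filter.atTop (nhds t₂) :=
    (continuous_snd.tendsto _).comp hgt
  have hre : ∀ z ∈ Metric.ball (0:ℂ) 1,
      (F z).re = t₁ * poissonKernel 0 z ζ₁ + t₂ * poissonKernel 0 z ζ₂ := by
    intro z hz
    have hz1 : ‖z‖ < 1 := by simpa using hz
    set p := poissonKernel 0 z with hp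
    have hpc : ContinuousOn p (Metric.sphere 0 1) := by
      have : p = fun x => (‖x - 0‖ ^ 2 - ‖z - 0‖ ^ 2) / ‖(x - 0) - (z - 0)‖ ^ 2 := by
        ext x; rw [hp, poissonKernel_def]
      rw [this]
      apply ContinuousOn.div (by fun_prop) (by fun_prop)
      intro x hx
      have hx1 : ‖x‖ = 1 := by simpa using hx
      have : x - z ≠ 0 := by
        intro h; rw [sub_eq_zero] at h; rw [h] at hx1; linarith
      simpa using this
    have hζ' : ‖ζ₁ - ζ₂‖ ^ 2 ≠ 0 := hζ.ne'
    have hk := hS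
    have hlim : Filter.Tendsto (fun n => v n z - (p ζ₁ * (T n).1 + p ζ₂ * (T n).2)) Filter.atTop
        (nhds 0) := by
      rw [Metric.tendsto_nhds]
      intro ε hε
      filter_upwards [hS (ε / 2) (by positivity) (fun x => p x - (p ζ₁ * l₁ x + p ζ₂ * l₂ x))
        (hpc.sub (by fun_prop)) (by
          simp only [hl₁, hl₂, sub_self, norm_zero, div_self hζ']; simp) (by
          simp only [hl₁, hl₂, sub_self, norm_zero]; rw [norm_sub_rev ζ₂ ζ₁, div_self hζ']; simp)] with n hn
      have hpo := (hvh n).circleAverage_poissonKernel_smul hz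
      have i0 : CircleIntegrable (fun x => p x * v n x) 0 1 :=
        (hpc.mul (hvc n)).circleIntegrable zero_le_one
      have i1 : CircleIntegrable (fun x => p ζ₁ • (l₁ x * v n x)) 0 1 :=
        (show ContinuousOn (fun x => p ζ₁ • (l₁ x * v n x)) (Metric.sphere 0 1) from
          (hl₁c.continuousOn.mul (hvc n)).const_smul (p ζ₁)).circleIntegrable zero_le_one
      have i2 : CircleIntegrable (fun x => p ζ₂ • (l₂ x * v n x)) 0 1 :=
        (show ContinuousOn (fun x => p ζ₂ • (l₂ x * v n x)) (Metric.sphere 0 1) from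
          (hl₂c.continuousOn.mul (hvc n)).const_smul (p ζ₂)).circleIntegrable zero_le_one
      have i3 : CircleIntegrable (fun x => p ζ₁ • (l₁ x * v n x) + p ζ₂ • (l₂ x * v n x)) 0 1 :=
        i1.add i2
      have e : Real.circleAverage (fun x => (p x - (p ζ₁ * l₁ x + p ζ₂ * l₂ x)) * v n x) 0 1 =
          v n z - (p ζ₁ * (T n).1 + p ζ₂ * (T n).2) := by
        have : (fun x => (p x - (p ζ₁ * l₁ x + p ζ₂ * l₂ x)) * v n x) =
            fun x => p x * v n x - (p ζ₁ • (l₁ x * v n x) + p ζ₂ • (l₂ x * v n x)) := by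
          ext x; simp only [smul_eq_mul]; ring
        rw [this, Real.circleAverage_fun_sub i0 i3, Real.circleAverage_fun_add i1 i2,
          Real.circleAverage_fun_smul, Real.circleAverage_fun_smul, ← hpo]
        rfl
      rw [e] at hn
      rw [Real.dist_eq, sub_zero]
      linarith
    have hlim2 : Filter.Tendsto (fun n => v (g n) z - (p ζ₁ * (T (g n)).1 + p ζ₂ * (T (g n)).2))
        Filter.atTop (nhds ((F z).re - (p ζ₁ * t₁ + p ζ₂ * t₂))) := by
      apply Filter.Tendsto.sub
      · have h3 : Filter.Tendsto (fun n => v n z) Filter.atTop (nhds (F z).re) := by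
          have hc : ContinuousAt F z := (hFa z hz).continuousAt
          have h4 : Filter.Tendsto (fun n => (r n : ℂ) * z) Filter.atTop (nhds z) := by
            have := ((Complex.continuous_ofReal.tendsto 1).comp hrt).mul_const z
            simpa using this
          exact (Complex.continuous_re.tendsto _).comp (hc.tendsto.comp h4)
        exact h3.comp hg.tendsto_atTop
      · exact (hT1.const_mul _).add (hT2.const_mul _)
    have := tendsto_nhds_unique hlim2 (hlim.comp hg.tendsto_atTop)
    linarith
  have hsum : t₁ + t₂ = 1 := by
    have := hre 0 (by simp)
    simp [h0, poissonKernel_def, h1, h2] at this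
    linarith
  refine ⟨t₁, t₂, htm.1.1, htm.2.1, hsum, ?_⟩
  set G : ℂ → ℂ := fun z => t₁ * ((ζ₁ + z) / (ζ₁ - z)) + t₂ * ((ζ₂ + z) / (ζ₂ - z)) with hG
  have hsub : ∀ ζ : ℂ, ‖ζ‖ = 1 → ∀ z ∈ Metric.ball (0:ℂ) 1, ζ - z ≠ 0 := by
    intro ζ h z hz hh
    rw [sub_eq_zero] at hh
    rw [hh] at h
    simp at hz
    linarith
  have hGd : DifferentiableOn ℂ G (Metric.ball 0 1) := by
    have a1 := hsub ζ₁ h1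
    have a2 := hsub ζ₂ h2
    fun_prop (disch := assumption)
  have hda : AnalyticOnNhd ℂ (fun z => F z - G z) (Metric.ball 0 1) :=
    (hF.sub hGd).analyticOnNhd Metric.isOpen_ball
  obtain ⟨c, hc⟩ := hda.eq_const_of_re_eq_const (c₀ := 0) (fun z hz => by
    have e1 := hre z hz
    have e2 : ∀ ζ, poissonKernel 0 z ζ = ((ζ + z) / (ζ - z)).re := fun ζ => by
      rw [poissonKernel_eq_re_herglotzRieszKernel]; simp [herglotzRieszKernel_def]
    simp only [sub_re, hG, add_re, re_ofReal_mul, e1, e2]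
    ring) Metric.isOpen_ball
    ((convex_ball _ _).isConnected ⟨0, by simp⟩)
  have hc0 := hc 0 (by simp)
  have n1 : ζ₁ ≠ 0 := by rintro rfl; simp at h1
  have n2 : ζ₂ ≠ 0 := by rintro rfl; simp at h2
  have hsumc : (t₁:ℂ) + t₂ = 1 := by exact_mod_cast hsum
  simp [hG, h0, n1, n2, hsumc] at hc0
  intro z hz
  have := hc z hz
  rw [← hc0] at this
  exact sub_eq_zero.mp this

lemma aux_roots (c a : ℂ) (hc : ‖c‖ = 1) (ha : ‖a‖ < 1) :
    ∃ ζ₁ ζ₂ : ℂ, ‖ζ₁‖ = 1 ∧ ‖ζ₂‖ = 1 ∧ ζ₁ ≠ ζ₂ ∧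
      ∀ l : ℂ, (1 - conj a * l) - c * l * (a - l) = c * ((l - ζ₁) * (l - ζ₂)) := by
  obtain ⟨d, hd⟩ := IsAlgClosed.exists_pow_nat_eq (conj c) (n := 2) (by norm_num)
  have hdn : ‖d‖ = 1 := by
    have : ‖d‖ ^ 2 = 1 := by rw [← norm_pow, hd]; simpa using hc
    nlinarith [norm_nonneg d]
  have hcc : c * conj c = 1 := by rw [mul_conj']; simp [hc]
  have hdd : d * conj d = 1 := by rw [mul_conj']; simp [hdn]
  have hcd : c = conj d ^ 2 := by rw [← map_pow, hd, conj_conj]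
  set x : ℝ := (a * conj d).re with hx
  have hx1 : x ^ 2 < 1 := by
    have h1 : |x| ≤ ‖a * conj d‖ := abs_re_le_norm _
    rw [norm_mul, RCLike.norm_conj, hdn, mul_one] at h1
    have : |x| < 1 := h1.trans_lt ha
    rw [sq_lt_one_iff_abs_lt_one]; exact this
  set y : ℝ := Real.sqrt (1 - x ^ 2) with hy
  have hy0 : 0 < y := Real.sqrt_pos.mpr (by linarith)
  have hy2 : y ^ 2 = 1 - x ^ 2 := Real.sq_sqrt (by linarith)
  have hy2c : (y:ℂ) ^ 2 = 1 - (x:ℂ) ^ 2 := by exact_mod_cast hy2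
  have h2x : 2 * (x:ℂ) = a * conj d + conj a * d := by
    have := add_conj (a * conj d)
    rw [map_mul, conj_conj] at this
    rw [this]; push_cast; rfl
  have hμ : ∀ w : ℝ, w ^ 2 = 1 - x ^ 2 → ‖(x:ℂ) + w * I‖ = 1 := by
    intro w hw
    have : ‖(x:ℂ) + w * I‖ ^ 2 = 1 := by
      rw [← normSq_eq_norm_sq, normSq_add_mul_I]; linarith
    nlinarith [norm_nonneg ((x:ℂ) + w * I)]
  refine ⟨d * (x + y * I), d * (x + ((-y : ℝ) : ℂ) * I), ?_, ?_, ?_, ?_⟩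
  · rw [norm_mul, hdn, hμ y hy2, one_mul]
  · rw [norm_mul, hdn, hμ (-y) (by rw [neg_sq, hy2]), one_mul]
  · intro h
    have hd0 : d ≠ 0 := by rintro rfl; simp at hdn
    have := congrArg im (mul_left_cancel₀ hd0 h)
    simp at this
    linarith
  · intro l
    have e1 : (l - d * (x + y * I)) * (l - d * (x + ((-y : ℝ) : ℂ) * I)) =
        l ^ 2 - (2 * (x:ℂ)) * d * l + d ^ 2 := by
      push_cast
      linear_combination d ^ 2 * hy2c - d ^ 2 * (y:ℂ) ^ 2 * I_sq
    rw [e1, h2x, hd]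
    have e2 : c * d = conj d := by rw [hcd]; linear_combination conj d * hdd
    have e3 : c * d ^ 2 = 1 := by rw [hd, hcc]
    linear_combination (-1:ℂ) * hcc + l * a * conj d * e2 + l * conj a * e3 - l * a * hcd

lemma aux_re (M N : ℂ) : ‖N - M‖ ^ 2 * ((N + M) / (N - M)).re ≤ ‖N‖ ^ 2 - ‖M‖ ^ 2 ∨ N = M := by
  by_cases h : N = M
  · exact Or.inr h
  · left
    have e2 : poissonKernel 0 M N = ((N + M) / (N - M)).re := by
      rw [poissonKernel_eq_re_herglotzRieszKernel]; simp [herglotzRieszKernel_def]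
    have : ‖N - M‖ ^ 2 ≠ 0 := by simpa [sub_eq_zero] using h
    rw [← e2, poissonKernel_def]
    simp only [sub_zero]
    rw [mul_div_cancel₀ _ this]

lemma aux_NM (a l : ℂ) (ha : ‖a‖ < 1) (hl : ‖l‖ < 1) (c : ℂ) (hc : ‖c‖ = 1) :
    ‖1 - conj a * l‖ ^ 2 - ‖c * l * (a - l)‖ ^ 2 ≤ 5 * (1 - ‖l‖ ^ 2) := by
  have e : ‖1 - conj a * l‖ ^ 2 - ‖a - l‖ ^ 2 = (1 - ‖a‖ ^ 2) * (1 - ‖l‖ ^ 2) := by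
    simp only [← normSq_eq_norm_sq, normSq_apply]
    simp
    ring
  have h4 : ‖1 - conj a * l‖ ^ 2 ≤ 4 := by
    have : ‖1 - conj a * l‖ ≤ 2 := by
      refine (norm_sub_le _ _).trans ?_
      rw [norm_mul, RCLike.norm_conj, norm_one]
      nlinarith [norm_nonneg a, norm_nonneg l]
    nlinarith [norm_nonneg (1 - conj a * l)]
  rw [norm_mul, norm_mul, hc, one_mul, mul_pow]
  have hl2 : 0 ≤ 1 - ‖l‖ ^ 2 := by nlinarith [norm_nonneg l]
  have ha2 : 0 ≤ 1 - ‖a‖ ^ 2 := by nlinarith [norm_nonneg a]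
  have e5 : ‖l‖ ^ 2 * (1 - ‖a‖ ^ 2) ≤ 1 := by
    nlinarith [sq_nonneg ‖l‖, sq_nonneg ‖a‖]
  have : ‖1 - conj a * l‖ ^ 2 - ‖l‖ ^ 2 * ‖a - l‖ ^ 2 =
      (1 - ‖l‖ ^ 2) * ‖1 - conj a * l‖ ^ 2 + ‖l‖ ^ 2 * (1 - ‖a‖ ^ 2) * (1 - ‖l‖ ^ 2) := by
    linear_combination ‖l‖ ^ 2 * e
  rw [this]
  nlinarith

lemma aux_cayley_re (w : ℂ) (hw : ‖w‖ < 1) : 0 ≤ (2 / (1 - w) - 1).re := by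
  have h1 : (1:ℂ) - w ≠ 0 := by
    intro h; rw [sub_eq_zero] at h; rw [← h] at hw; simp at hw
  have e : 2 / (1 - w) - 1 = (1 + w) / (1 - w) := by field_simp; ring
  have e2 : poissonKernel 0 w 1 = ((1 + w) / (1 - w)).re := by
    rw [poissonKernel_eq_re_herglotzRieszKernel]; simp [herglotzRieszKernel_def]
  rw [e, ← e2, poissonKernel_def]
  simp only [sub_zero, norm_one]
  apply div_nonneg _ (by positivity)
  nlinarith [norm_nonneg w]

lemma aux_aut (φ : ℂ → ℂ) (hφd : DifferentiableOn ℂ φ uDisc) (hφm : ∀ l ∈ uDisc, ‖φ l‖ < 1)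
    (ζ₁ ζ₂ : ℂ) (h1 : ‖ζ₁‖ = 1) (h2 : ‖ζ₂‖ = 1) (hne : ζ₁ ≠ ζ₂) (C : ℝ)
    (hb : ∀ l ∈ uDisc, ‖l - ζ₁‖ ^ 2 * ‖l - ζ₂‖ ^ 2 * (2 / (1 - l * φ l) - 1).re ≤
      C * (1 - ‖l‖ ^ 2)) : IsDiscAut φ := by
  have hD : uDisc = Metric.ball (0:ℂ) 1 := by ext; simp [uDisc]
  have hlt : ∀ l ∈ uDisc, ‖l * φ l‖ < 1 := fun l hl => by
    have h : ‖l‖ < 1 := hl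
    rw [norm_mul]
    nlinarith [hφm l hl, norm_nonneg l, norm_nonneg (φ l)]
  have hn : ∀ l ∈ uDisc, 1 - l * φ l ≠ 0 := fun l hl h => by
    have := hlt l hl
    rw [sub_eq_zero] at h
    rw [← h] at this
    simp at this
  obtain ⟨t₁, t₂, ht1, ht2, hts, ht⟩ := aux_herglotz (fun l => 2 / (1 - l * φ l) - 1)
    (by rw [← hD]; fun_prop (disch := assumption)) (by norm_num)
    (by rw [← hD]; exact fun z hz => aux_cayley_re _ (hlt z hz)) ζ₁ ζ₂ h1 h2 hne C
    (by rw [← hD]; exact hb)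
  have htsc : (t₁:ℂ) + t₂ = 1 := by exact_mod_cast hts
  rw [← hD] at ht
  have c1 : ζ₁ * conj ζ₁ = 1 := by rw [mul_conj']; simp [h1]
  have c2 : ζ₂ * conj ζ₂ = 1 := by rw [mul_conj']; simp [h2]
  set a : ℂ := t₂ * ζ₁ + t₁ * ζ₂ with ha
  have hca : conj a = t₂ * conj ζ₁ + t₁ * conj ζ₂ := by simp [ha]
  have ha1 : ‖a‖ ≤ 1 := by
    refine (norm_add_le _ _).trans ?_
    rw [norm_mul, norm_mul, h1, h2, norm_real, norm_real, Real.norm_of_nonneg ht1,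
      Real.norm_of_nonneg ht2]
    linarith
  set c : ℂ := conj (ζ₁ * ζ₂) with hcdef
  have hc : ‖c‖ = 1 := by rw [hcdef, RCLike.norm_conj, norm_mul, h1, h2, one_mul]
  have key0 : ∀ l ∈ uDisc, l ≠ 0 → φ l * (1 - conj a * l) = c * (a - l) := by
    intro l hl hl0
    have h := ht l hl
    have n0 := hn l hl
    have hl1 : ‖l‖ < 1 := hl
    have n1 : ζ₁ - l ≠ 0 := by
      intro h; rw [sub_eq_zero] at h; rw [h] at h1; linarith
    have n2 : ζ₂ - l ≠ 0 := by
      intro h; rw [sub_eq_zero] at h; rw [h] at h2; linarith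
    field_simp at h
    apply mul_left_cancel₀ hl0
    have ht1e : (t₁:ℂ) = 1 - t₂ := by linear_combination htsc
    rw [ht1e] at h
    rw [hca, ha, hcdef, map_mul, ht1e]
    have h' : l * φ l * (ζ₁ * ζ₂ - l * ((1 - t₂) * ζ₁ + t₂ * ζ₂)) =
        l * (t₂ * ζ₁ + (1 - t₂) * ζ₂ - l) := by
      linear_combination (1/2) * h
    have k1 : ζ₁ ≠ 0 := by rintro rfl; simp at h1
    have k2 : ζ₂ ≠ 0 := by rintro rfl; simp at h2
    rw [eq_inv_of_mul_eq_one_right c1, eq_inv_of_mul_eq_one_right c2]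
    field_simp
    field_simp at h'
    linear_combination h'
  have hcont : ∀ l ∈ uDisc, φ l * (1 - conj a * l) = c * (a - l) := by
    intro l hl
    by_cases hl0 : l = 0
    · subst hl0
      have hopen : IsOpen uDisc := by rw [hD]; exact Metric.isOpen_ball
      have hφc : ContinuousAt φ 0 := (hφd.differentiableAt (hopen.mem_nhds hl)).continuousAt
      have ev : ∀ᶠ l in nhdsWithin (0:ℂ) {0}ᶜ, φ l * (1 - conj a * l) = c * (a - l) := by
        filter_upwards [self_mem_nhdsWithin, mem_nhdsWithin_of_mem_nhds (hopen.mem_nhds hl)] with l h h'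
        exact key0 l h' h
      have L1 : ContinuousAt (fun l => φ l * (1 - conj a * l)) 0 := by fun_prop
      have L2 : ContinuousAt (fun l => c * (a - l)) 0 := by fun_prop
      exact tendsto_nhds_unique_of_eventuallyEq (L1.tendsto.mono_left nhdsWithin_le_nhds)
        (L2.tendsto.mono_left nhdsWithin_le_nhds) ev
    · exact key0 l hl hl0
  have ha2 : ‖a‖ < 1 := by
    have h := hcont 0 (by simp [uDisc])
    have h' := hφm 0 (by simp [uDisc])
    simp at h
    rw [h, norm_mul, hc, one_mul] at h'
    exact h'
  refine ⟨c, a, hc, ha2, fun l hl => ?_⟩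
  have hl1 : ‖l‖ < 1 := hl
  have hnz : 1 - conj a * l ≠ 0 := by
    intro h
    rw [sub_eq_zero] at h
    have := congrArg norm h
    rw [norm_mul, RCLike.norm_conj, norm_one] at this
    nlinarith [norm_nonneg a, norm_nonneg l]
  rw [mob, mul_div_assoc', eq_div_iff hnz, hcont l hl]

lemma aut_of_mul (η : ℂ) (hη : ‖η‖ = 1) (φ : ℂ → ℂ) (h : IsDiscAut (fun l => η * φ l)) :
    IsDiscAut φ := by
  obtain ⟨c, a, hc, ha, h⟩ := h
  have h0 : η ≠ 0 := by rintro rfl; simp at hη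
  refine ⟨η⁻¹ * c, a, by simp [hη, hc], ha, fun l hl => ?_⟩
  rw [mul_assoc, ← h l hl, inv_mul_cancel_left₀ h0]

/-- if `λ ↦ Φ_{s,η}(λ φ(λ), λ ψ(λ))` is a Blaschke product of degree `2`,
then `φ` and `ψ` are Möbius maps (automorphisms of the disc). -/
theorem statement_10 (s : ℝ) (hs : s ∈ Ioo (0:ℝ) 1) (η : ℂ) (hη : ‖η‖ = 1)
    (φ ψ : ℂ → ℂ)
    (hφd : DifferentiableOn ℂ φ uDisc) (hψd : DifferentiableOn ℂ ψ uDisc)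
    (hφm : ∀ l ∈ uDisc, ‖φ l‖ < 1) (hψm : ∀ l ∈ uDisc, ‖ψ l‖ < 1)
    (hB : IsBlaschkeDeg 2 (fun l => PhiMagic s η (l * φ l) (l * ψ l))) :
    IsDiscAut φ ∧ IsDiscAut ψ := by
  obtain ⟨hs0, hs1⟩ := hs
  have hη0 : η ≠ 0 := by rintro rfl; simp at hη
  obtain ⟨c₀, hc₀, b, hb, hBl⟩ := hB
  -- normal form of the Blaschke product
  obtain ⟨c, a, hc, ha, hΦ⟩ : ∃ c a : ℂ, ‖c‖ = 1 ∧ ‖a‖ < 1 ∧ ∀ l ∈ uDisc,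
      η * PhiMagic s η (l * φ l) (l * ψ l) = c * l * (a - l) / (1 - conj a * l) := by
    have h0 := hBl 0 (by simp [uDisc])
    simp [PhiMagic, mob, Fin.prod_univ_two] at h0
    have hc00 : c₀ ≠ 0 := by rintro rfl; simp at hc₀
    rcases h0 with h | h | h
    · exact absurd h hc00
    · refine ⟨-(η * c₀), b 1, by simp [hη, hc₀], hb 1, fun l hl => ?_⟩
      have := hBl l hl
      simp only at this
      rw [this]
      simp [Fin.prod_univ_two, mob, h]
      ring
    · refine ⟨-(η * c₀), b 0, by simp [hη, hc₀], hb 0, fun l hl => ?_⟩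
      have := hBl l hl
      simp only at this
      rw [this]
      simp [Fin.prod_univ_two, mob, h]
      ring
  obtain ⟨ζ₁, ζ₂, h1, h2, hne, hroots⟩ := aux_roots c a hc ha
  have hlt : ∀ χ : ℂ → ℂ, (∀ l ∈ uDisc, ‖χ l‖ < 1) → ∀ l ∈ uDisc, ‖l * (η * χ l)‖ < 1 := by
    intro χ hχ l hl
    have h : ‖l‖ < 1 := hl
    rw [norm_mul, norm_mul, hη, one_mul]
    nlinarith [hχ l hl, norm_nonneg l, norm_nonneg (χ l)]
  have hmain : ∀ l ∈ uDisc, ‖l - ζ₁‖ ^ 2 * ‖l - ζ₂‖ ^ 2 *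
      (s * (2 / (1 - l * (η * φ l)) - 1).re + (1 - s) * (2 / (1 - l * (η * ψ l)) - 1).re) ≤
      5 * (1 - ‖l‖ ^ 2) := by
    intro l hl
    have hl1 : ‖l‖ < 1 := hl
    have hf := hlt φ hφm l hl
    have hg := hlt ψ hψm l hl
    have hΦl := hΦ l hl
    set f := l * (η * φ l) with hfd
    set g := l * (η * ψ l) with hgd
    have nf : 1 - f ≠ 0 := by
      intro h; rw [sub_eq_zero] at h; rw [← h] at hf; simp at hf
    have ng : 1 - g ≠ 0 := by
      intro h; rw [sub_eq_zero] at h; rw [← h] at hg; simp at hg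
    have hNn : 1 - conj a * l ≠ 0 := by
      intro h
      rw [sub_eq_zero] at h
      have := congrArg norm h
      rw [norm_mul, RCLike.norm_conj, norm_one] at this
      nlinarith [norm_nonneg a, norm_nonneg l]
    have hDn : 1 - ((1 - (s:ℂ)) * f + s * g) ≠ 0 := by
      intro h
      rw [sub_eq_zero] at h
      have h' := congrArg norm h
      have h3 : ‖(1 - (s:ℂ)) * f + s * g‖ ≤ (1 - s) * ‖f‖ + s * ‖g‖ := by
        refine (norm_add_le _ _).trans ?_
        rw [norm_mul _ f, norm_mul _ g, norm_real, Real.norm_of_nonneg hs0.le,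
          show (1 - (s:ℂ)) = ((1 - s : ℝ) : ℂ) by push_cast; rfl, norm_real,
          Real.norm_of_nonneg (by linarith)]
      rw [norm_one] at h'
      nlinarith
    have hP : η * PhiMagic s η (l * φ l) (l * ψ l) =
        (s * f + (1 - s) * g - f * g) / (1 - ((1 - (s:ℂ)) * f + s * g)) := by
      rw [PhiMagic, mul_div_assoc', hfd, hgd]
      congr 1 <;> ring
    rw [hP] at hΦl
    set N := 1 - conj a * l with hN
    set M := c * l * (a - l) with hM
    have hcross : (s * f + (1 - s) * g - f * g) * N = M * (1 - ((1 - (s:ℂ)) * f + s * g)) := by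
      rwa [div_eq_div_iff hDn hNn] at hΦl
    have hNM' : (N - M) * (1 - ((1 - (s:ℂ)) * f + s * g)) = (1 - f) * (1 - g) * N := by
      linear_combination hcross
    have hNM : N - M ≠ 0 := by
      intro h
      rw [h, zero_mul] at hNM'
      exact mul_ne_zero (mul_ne_zero nf ng) hNn hNM'.symm
    have hid : (s:ℂ) * (2 / (1 - f) - 1) + ((1 - s : ℝ) : ℂ) * (2 / (1 - g) - 1) =
        (N + M) / (N - M) := by
      have e1 : (N + M) / (N - M) = 2 * (N / (N - M)) - 1 := by field_simp; ring
      have e2 : N / (N - M) = (1 - ((1 - (s:ℂ)) * f + s * g)) / ((1 - f) * (1 - g)) := by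
        rw [div_eq_div_iff hNM (mul_ne_zero nf ng)]
        linear_combination -hNM'
      rw [e1, e2]
      push_cast
      field_simp
      ring
    have hre := congrArg re hid
    rw [add_re, re_ofReal_mul, re_ofReal_mul] at hre
    rw [hre]
    have hnorm : ‖l - ζ₁‖ ^ 2 * ‖l - ζ₂‖ ^ 2 = ‖N - M‖ ^ 2 := by
      rw [hN, hM, hroots l, norm_mul, norm_mul, hc]; ring
    rw [hnorm]
    rcases aux_re M N with h | h
    · exact h.trans (aux_NM a l ha hl1 c hc)
    · exact absurd (sub_eq_zero.mpr h) hNM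
  have hnb : ∀ χ : ℂ → ℂ, (∀ l ∈ uDisc, ‖χ l‖ < 1) → ∀ l ∈ uDisc, ‖η * χ l‖ < 1 := by
    intro χ hχ l hl
    rw [norm_mul, hη, one_mul]; exact hχ l hl
  constructor
  · apply aut_of_mul η hη
    apply aux_aut _ (hφd.const_mul η) (hnb φ hφm) ζ₁ ζ₂ h1 h2 hne (5 / s)
    intro l hl
    have h := hmain l hl
    have p2 := aux_cayley_re _ (hlt ψ hψm l hl)
    have hq : 0 ≤ ‖l - ζ₁‖ ^ 2 * ‖l - ζ₂‖ ^ 2 := by positivity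
    rw [div_mul_eq_mul_div, le_div_iff₀ hs0]
    have := mul_nonneg hq (mul_nonneg (sub_nonneg.mpr hs1.le) p2)
    linarith
  · apply aut_of_mul η hη
    apply aux_aut _ (hψd.const_mul η) (hnb ψ hψm) ζ₁ ζ₂ h1 h2 hne (5 / (1 - s))
    intro l hl
    have h := hmain l hl
    have p2 := aux_cayley_re _ (hlt φ hφm l hl)
    have hq : 0 ≤ ‖l - ζ₁‖ ^ 2 * ‖l - ζ₂‖ ^ 2 := by positivity
    rw [div_mul_eq_mul_div, le_div_iff₀ (by linarith)]
    have := mul_nonneg hq (mul_nonneg hs0.le p2)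
    linarith
end
end

section
/- Let N ≥ 2, let f : 𝔻 → 𝔻ⁿ and F : 𝔻ⁿ → 𝔻 be holomorphic, and suppose that b := F∘f is a nonconstant Blaschke product of degree at most N − 1. Then for all pairwise distinct λ_1, …, λ_N ∈ 𝔻 the N-point Pick interpolation problem on 𝔻ⁿ sending f(λ_j) to b(λ_j), j = 1, …, N, is extremal: it is solved by F, and there is no holomorphic G : 𝔻ⁿ → ℂ with sup_{𝔻ⁿ}|G| < 1 and G(f(λ_j)) = b(λ_j) for all j. -/
open Complex Set ComplexConjugate

noncomputable section

lemma aux_re_nonpos (ρ : ℝ) (hρ : 0 < ρ) (H : ℂ → ℂ)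
    (hH : DiffContOnCl ℂ H (Metric.ball 0 ρ)) (D : ℂ) :
    ∃ z : ℂ, ‖z‖ = ρ ∧ (D * z * H z).re ≤ 0 := by
  have hd : DiffContOnCl ℂ (fun z => Complex.exp (-(D * z * H z))) (Metric.ball 0 ρ) := by
    have h1 : DiffContOnCl ℂ (fun z : ℂ => -(D * z)) (Metric.ball 0 ρ) :=
      Differentiable.diffContOnCl (by fun_prop)
    have h2 := h1.smul hH
    have h3 := (Complex.differentiable_exp).comp_diffContOnCl h2
    have h4 : (fun z => Complex.exp (-(D * z * H z))) =
        Complex.exp ∘ fun x => -(D * x) • H x := by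
      funext z; simp [smul_eq_mul]
    rw [h4]; exact h3
  obtain ⟨z, hz, hm⟩ := Complex.exists_mem_frontier_isMaxOn_norm Metric.isBounded_ball
    ⟨0, Metric.mem_ball_self hρ⟩ hd
  rw [frontier_ball _ hρ.ne'] at hz
  refine ⟨z, by simpa using hz, ?_⟩
  have := hm (subset_closure (Metric.mem_ball_self hρ : (0:ℂ) ∈ Metric.ball 0 ρ))
  simp only [Function.comp, Set.mem_ofPred_eq, Complex.norm_exp] at this
  simpa using this

lemma aux_factor (U : Set ℂ) (hU : IsOpen U) (m : ℕ) :
    ∀ (φ : ℂ → ℂ) (x : Fin m → ℂ), DifferentiableOn ℂ φ U → (∀ j, x j ∈ U) →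
      Function.Injective x → (∀ j, φ (x j) = 0) →
      ∃ h : ℂ → ℂ, DifferentiableOn ℂ h U ∧ ∀ z ∈ U, φ z = (∏ j, (z - x j)) * h z := by
  induction m with
  | zero => intro φ x hφ _ _ _; exact ⟨φ, hφ, by simp⟩
  | succ m ih =>
    intro φ x hφ hx hi h0
    have key : ∀ z, φ z = (z - x 0) * dslope φ (x 0) z := by
      intro z
      have := sub_smul_dslope φ (x 0) z
      rw [h0 0, sub_zero, smul_eq_mul] at this
      exact this.symm
    obtain ⟨h, hd, hh⟩ := ih (dslope φ (x 0)) (fun j => x j.succ)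
      ((Complex.differentiableOn_dslope (hU.mem_nhds (hx 0))).2 hφ) (fun j => hx _)
      (fun i j hij => Fin.succ_injective _ (hi hij)) (by
        intro j
        have h1 := key (x j.succ)
        rw [h0] at h1
        have h2 : x j.succ - x 0 ≠ 0 :=
          sub_ne_zero.2 (fun h => Fin.succ_ne_zero j (hi h))
        exact (mul_eq_zero.1 h1.symm).resolve_left h2)
    refine ⟨h, hd, fun z hz => ?_⟩
    rw [key z, hh z hz, Fin.prod_univ_succ, mul_assoc]

lemma aux_one_sub_ne (a z : ℂ) (ha : ‖a‖ < 1) (hz : ‖z‖ < 1) : 1 - conj a * z ≠ 0 := by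
  intro h
  have h1 : ‖conj a * z‖ = 1 := by rw [← sub_eq_zero.1 h]; simp
  rw [norm_mul, RCLike.norm_conj] at h1
  nlinarith [norm_nonneg a, norm_nonneg z]

lemma aux_mob_lower (a z : ℂ) (ha : ‖a‖ < 1) (hz : ‖z‖ < 1) (haz : ‖a‖ < ‖z‖) :
    (‖z‖ - ‖a‖) / (1 - ‖a‖ * ‖z‖) ≤ ‖mob a z‖ := by
  have hne := aux_one_sub_ne a z ha hz
  have hp : 0 < ‖1 - conj a * z‖ := norm_pos_iff.2 hne
  have hq : 0 < 1 - ‖a‖ * ‖z‖ := by nlinarith [norm_nonneg a, norm_nonneg z]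
  unfold mob
  rw [norm_div, div_le_div_iff₀ hq hp]
  have e1 : ‖a - z‖ ^ 2 = ‖a‖ ^ 2 + ‖z‖ ^ 2 - 2 * (a * conj z).re := by
    simp only [← Complex.normSq_eq_norm_sq, Complex.normSq_sub]
  have e2 : ‖1 - conj a * z‖ ^ 2 = 1 + ‖a‖ ^ 2 * ‖z‖ ^ 2 - 2 * (a * conj z).re := by
    simp only [← Complex.normSq_eq_norm_sq, Complex.normSq_sub]
    simp
  have e3 : (a * conj z).re ≤ ‖a‖ * ‖z‖ := by
    have := Complex.re_le_norm (a * conj z)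
    rwa [norm_mul, RCLike.norm_conj] at this
  apply le_of_sq_le_sq _ (by positivity)
  rw [mul_pow, mul_pow, e1, e2]
  have hpn := norm_nonneg a
  generalize (a * conj z).re = t at *
  generalize ‖a‖ = p at *
  generalize ‖z‖ = q at *
  have hp0 : 0 ≤ p := hpn
  have hq0 : 0 ≤ q := hp0.trans haz.le
  have hid : (p ^ 2 + q ^ 2 - 2 * t) * (1 - p * q) ^ 2 - (q - p) ^ 2 * (1 + p ^ 2 * q ^ 2 - 2 * t)
    = 2 * (p * q - t) * ((1 - p ^ 2) * (1 - q ^ 2)) := by ring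
  have h1 : 0 ≤ 1 - p ^ 2 := by nlinarith
  have h2 : 0 ≤ 1 - q ^ 2 := by nlinarith
  have h3 : 0 ≤ p * q - t := by linarith
  have h4 : 0 ≤ 2 * (p * q - t) * ((1 - p ^ 2) * (1 - q ^ 2)) := by positivity
  linarith

lemma aux_radius (d m : ℕ) (a : Fin d → ℂ) (ha : ∀ j, ‖a j‖ < 1) (x : Fin m → ℂ)
    (hx : ∀ j, ‖x j‖ < 1) (r : ℝ) (hr : r < 1) :
    ∃ ρ : ℝ, 0 < ρ ∧ ρ < 1 ∧ (∀ j, ‖a j‖ < ρ) ∧ (∀ j, ‖x j‖ < ρ) ∧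
      ∀ z : ℂ, ‖z‖ = ρ → r < ∏ j, ‖mob (a j) z‖ := by
  have hc : ContinuousAt (fun t : ℝ => ∏ j, (t - ‖a j‖) / (1 - ‖a j‖ * t)) 1 := by
    refine tendsto_finsetProd _ fun j _ => ?_
    refine ContinuousAt.div (by fun_prop) (by fun_prop) ?_
    have := ha j
    simp only [mul_one]; linarith
  have h1 : ∏ j, ((1:ℝ) - ‖a j‖) / (1 - ‖a j‖ * 1) = 1 := by
    refine Finset.prod_eq_one fun j _ => ?_
    have := ha j
    rw [mul_one, div_self]; linarith
  have hev : ∀ᶠ t in nhds (1:ℝ), r < ∏ j, (t - ‖a j‖) / (1 - ‖a j‖ * t) :=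
    hc.eventually (lt_mem_nhds (hr.trans_eq h1.symm))
  have hall : ∀ᶠ t in nhdsWithin (1:ℝ) (Set.Iio 1), 0 < t ∧ t < 1 ∧ (∀ j, ‖a j‖ < t) ∧
      (∀ j, ‖x j‖ < t) ∧ r < ∏ j, (t - ‖a j‖) / (1 - ‖a j‖ * t) := by
    filter_upwards [self_mem_nhdsWithin, nhdsWithin_le_nhds hev,
      nhdsWithin_le_nhds (lt_mem_nhds (zero_lt_one (α := ℝ))),
      nhdsWithin_le_nhds (Filter.eventually_all.2 fun j => lt_mem_nhds (ha j)),
      nhdsWithin_le_nhds (Filter.eventually_all.2 fun j => lt_mem_nhds (hx j))]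
      with t h1 h2 h3 h4 h5
    exact ⟨h3, h1, h4, h5, h2⟩
  obtain ⟨ρ, h0, h1, h2, h3, h4⟩ := hall.exists
  refine ⟨ρ, h0, h1, h2, h3, fun z hz => h4.trans_le ?_⟩
  refine Finset.prod_le_prod (fun j _ => ?_) (fun j _ => ?_)
  · have := h2 j
    have := ha j
    apply div_nonneg
    · linarith
    · nlinarith [norm_nonneg (a j)]
  · subst hz
    exact aux_mob_lower _ _ (ha j) h1 (h2 j)

lemma aux_conj_prod (m : ℕ) (x : Fin m → ℂ) (ρ : ℝ) (z : ℂ) (hz : ‖z‖ = ρ) :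
    conj (∏ j, ((ρ:ℂ) ^ 2 - conj (x j) * z)) * z ^ m
      = ((ρ:ℂ) ^ 2) ^ m * ∏ j, (z - x j) := by
  have hzz : conj z * z = (ρ:ℂ) ^ 2 := by rw [Complex.conj_mul', hz]
  have e1 : z ^ m = ∏ _j : Fin m, z := by simp
  have e2 : ((ρ:ℂ) ^ 2) ^ m = ∏ _j : Fin m, (ρ:ℂ) ^ 2 := by simp
  rw [map_prod, e1, e2, ← Finset.prod_mul_distrib, ← Finset.prod_mul_distrib]
  refine Finset.prod_congr rfl fun j _ => ?_
  simp only [map_sub, map_mul, map_pow, Complex.conj_ofReal, Complex.conj_conj]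
  linear_combination (-x j) * hzz

lemma aux_prod_ne (m : ℕ) (x : Fin m → ℂ) (ρ : ℝ) (hx : ∀ j, ‖x j‖ < ρ) (z : ℂ)
    (hz : ‖z‖ ≤ ρ) (hρ : 0 < ρ) : ∏ j, ((ρ:ℂ) ^ 2 - conj (x j) * z) ≠ 0 := by
  refine Finset.prod_ne_zero_iff.2 fun j _ h => ?_
  have h1 : ‖conj (x j) * z‖ = ρ ^ 2 := by
    rw [← sub_eq_zero.1 h]; simp
  rw [norm_mul, RCLike.norm_conj] at h1
  nlinarith [norm_nonneg (x j), norm_nonneg z, hx j]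

lemma aux_main (d : ℕ) (b g : ℂ → ℂ) (hb : IsBlaschkeDeg d b)
    (hg : DifferentiableOn ℂ g uDisc) (r : ℝ) (hr : r < 1) (hgr : ∀ z ∈ uDisc, ‖g z‖ ≤ r)
    (x : Fin (d + 1) → ℂ) (hx : ∀ j, x j ∈ uDisc) (hi : Function.Injective x)
    (heq : ∀ j, g (x j) = b (x j)) : False := by
  obtain ⟨c, hc, a, ha, hbf⟩ := hb
  have hc0 : c ≠ 0 := by rintro rfl; simp at hc
  have hUo : IsOpen uDisc := isOpen_lt continuous_norm continuous_const
  have hbd : DifferentiableOn ℂ b uDisc := by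
    refine DifferentiableOn.congr (f := fun l => c * ∏ j, mob (a j) l) ?_ hbf
    refine DifferentiableOn.const_mul ?_ c
    refine DifferentiableOn.fun_finsetProd fun j _ => ?_
    unfold mob
    exact DifferentiableOn.div (by fun_prop) (by fun_prop) fun z hz => aux_one_sub_ne _ _ (ha j) hz
  obtain ⟨h, hhd, hh⟩ := aux_factor uDisc hUo (d + 1) (fun z => b z - g z) x (hbd.sub hg) hx hi
    (fun j => by simp [heq j])
  obtain ⟨ρ, hρ, hρ1, haρ, hxρ, hbig⟩ := aux_radius d (d + 1) a ha x hx r hr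
  have hcl : Metric.closedBall (0:ℂ) ρ ⊆ uDisc := by
    intro z hz
    have : ‖z‖ ≤ ρ := by simpa using hz
    exact this.trans_lt hρ1
  set A : ℂ → ℂ := fun z => ∏ j, (1 - conj (a j) * z) with hA
  set S : ℂ → ℂ := fun z => ∏ j, ((ρ:ℂ) ^ 2 - conj (a j) * z) with hS
  set L : ℂ → ℂ := fun z => ∏ j, ((ρ:ℂ) ^ 2 - conj (x j) * z) with hL
  have hHd : DifferentiableOn ℂ (fun z => h z * A z * S z / L z) (Metric.closedBall 0 ρ) := by
    refine DifferentiableOn.div ?_ ?_ ?_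
    · refine ((hhd.mono hcl).mul ?_).mul ?_
      · exact DifferentiableOn.fun_finsetProd fun j _ => by fun_prop
      · exact DifferentiableOn.fun_finsetProd fun j _ => by fun_prop
    · exact DifferentiableOn.fun_finsetProd fun j _ => by fun_prop
    · intro z hz
      exact aux_prod_ne _ x ρ hxρ z (by simpa using hz) hρ
  have hH : DiffContOnCl ℂ (fun z => h z * A z * S z / L z) (Metric.ball 0 ρ) := by
    apply DifferentiableOn.diffContOnCl
    rwa [closure_ball _ hρ.ne']
  obtain ⟨z, hz, hre⟩ := aux_re_nonpos ρ hρ _ hH (c⁻¹ * (-1) ^ d)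
  have hzU : z ∈ uDisc := by show ‖z‖ < 1; linarith
  have hz0 : z ≠ 0 := by rintro rfl; simp at hz; linarith
  have hρ0 : (ρ:ℂ) ≠ 0 := by exact_mod_cast hρ.ne'
  have hS0 : S z ≠ 0 := aux_prod_ne _ a ρ haρ z hz.le hρ
  have hL0 : L z ≠ 0 := aux_prod_ne _ x ρ hxρ z hz.le hρ
  have hA0 : A z ≠ 0 := Finset.prod_ne_zero_iff.2 fun j _ => aux_one_sub_ne _ _ (ha j) hzU
  have hSc := aux_conj_prod d a ρ z hz
  have hLc := aux_conj_prod (d + 1) x ρ z hz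
  have hgb : ‖g z‖ < ‖b z‖ := by
    refine (hgr z hzU).trans_lt ?_
    rw [hbf z hzU, norm_mul, hc, one_mul, norm_prod]
    exact hbig z hz
  have hb0 : b z ≠ 0 := norm_pos_iff.1 ((norm_nonneg _).trans_lt hgb)
  have hbA : b z * A z = c * (-1) ^ d * ∏ j, (z - a j) := by
    have e1 : ((-1:ℂ)) ^ d = ∏ _j : Fin d, (-1:ℂ) := by simp
    rw [hbf z hzU, mul_assoc, mul_assoc, hA, e1]
    simp only [← Finset.prod_mul_distrib]
    congr 1
    refine Finset.prod_congr rfl fun j _ => ?_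
    unfold mob
    rw [div_mul_cancel₀ _ (aux_one_sub_ne _ _ (ha j) hzU)]
    ring
  have hhz := hh z hzU
  change conj (S z) * z ^ d = _ at hSc
  change conj (L z) * z ^ (d + 1) = _ at hLc
  have hLc0 : conj (L z) ≠ 0 := by simpa using hL0
  have hP0 : ∏ j, (z - x j) ≠ 0 := by
    intro h0
    rw [h0, mul_zero] at hLc
    exact mul_ne_zero hLc0 (pow_ne_zero _ hz0) hLc
  have key : c⁻¹ * (-1) ^ d * z * (h z * A z * S z / L z)
      = ((ρ ^ 2 * (‖S z‖ ^ 2 / ‖L z‖ ^ 2) : ℝ) : ℂ) * (1 - g z / b z) := by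
    have n1 : ((‖S z‖ ^ 2 : ℝ) : ℂ) = conj (S z) * S z := by
      rw [Complex.conj_mul']; push_cast; rfl
    have n2 : ((‖L z‖ ^ 2 : ℝ) : ℂ) = conj (L z) * L z := by
      rw [Complex.conj_mul']; push_cast; rfl
    rw [Complex.ofReal_mul, Complex.ofReal_div, n1, n2]
    have f1 : 1 - g z / b z = (∏ j, (z - x j)) * h z / b z := by
      rw [← hhz]; field_simp
    have f2 : A z = c * (-1) ^ d * (∏ j, (z - a j)) / b z := by
      rw [← hbA]; field_simp
    have f3 : conj (S z) = ((ρ:ℂ) ^ 2) ^ d * (∏ j, (z - a j)) / z ^ d := by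
      rw [← hSc]; field_simp
    have f4 : conj (L z) = ((ρ:ℂ) ^ 2) ^ (d + 1) * (∏ j, (z - x j)) / z ^ (d + 1) := by
      rw [← hLc]; field_simp
    have f5 : ((-1:ℂ)) ^ d * (-1) ^ d = 1 := by
      rw [← mul_pow]; simp
    rw [f1, f2, f3, f4]
    push_cast
    generalize ∏ j, (z - a j) = Q at *
    generalize ∏ j, (z - x j) = P at *
    generalize ((-1:ℂ)) ^ d = e at *
    have he : e ^ 2 = 1 := by rw [sq, f5]
    field_simp
    rw [he]
    try ring
  rw [key, Complex.re_ofReal_mul] at hre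
  have hpos : 0 < ρ ^ 2 * (‖S z‖ ^ 2 / ‖L z‖ ^ 2) := by
    have := norm_pos_iff.2 hS0
    have := norm_pos_iff.2 hL0
    positivity
  have hre2 : (1 - g z / b z).re ≤ 0 := by
    by_contra hcon
    exact absurd hre (not_le.2 (mul_pos hpos (not_le.1 hcon)))
  have h5 : ‖g z / b z‖ < 1 := by
    rw [norm_div, div_lt_one (norm_pos_iff.2 hb0)]; exact hgb
  have h6 := Complex.re_le_norm (g z / b z)
  rw [Complex.sub_re, Complex.one_re] at hre2
  linarith

/-- if `b = F ∘ f` is a nonconstant Blaschke product of degree at most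
`N − 1` for a complex `N`-geodesic `f` with left inverse `F`, then for any pairwise
distinct `λ_1, …, λ_N ∈ 𝔻` the `N`-point Pick problem `f(λ_j) ↦ b(λ_j)` is extremal,
and it is solved by `F`. -/
theorem statement_15 (n N : ℕ) (hN : 2 ≤ N)
    (f : ℂ → Fin n → ℂ) (F : (Fin n → ℂ) → ℂ)
    (hfd : DifferentiableOn ℂ f uDisc) (hfm : ∀ l ∈ uDisc, f l ∈ uPolydisc n)
    (hFd : DifferentiableOn ℂ F (uPolydisc n)) (hFm : ∀ x ∈ uPolydisc n, ‖F x‖ < 1)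
    (hb : IsBlaschkeLe (N - 1) (F ∘ f))
    (hnc : ∃ l1 ∈ uDisc, ∃ l2 ∈ uDisc, F (f l1) ≠ F (f l2))
    (lam : Fin N → ℂ) (hlam : ∀ j, lam j ∈ uDisc) (hinj : Function.Injective lam) :
    Interpolates n N (fun j => f (lam j)) (fun j => F (f (lam j))) F ∧
    ExtremalPick n N (fun j => f (lam j)) (fun j => F (f (lam j))) := by
  have hI : Interpolates n N (fun j => f (lam j)) (fun j => F (f (lam j))) F :=
    ⟨hFd, fun x hx => (hFm x hx).le, fun j => rfl⟩
  refine ⟨hI, ⟨F, hI⟩, ?_⟩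
  rintro ⟨G, hGd, ⟨r, hr, hGr⟩, hG⟩
  obtain ⟨d, hd, hb⟩ := hb
  have hle : d + 1 ≤ N := by omega
  refine aux_main d (F ∘ f) (G ∘ f) hb (hGd.comp hfd hfm) r hr (fun z hz => hGr _ (hfm z hz))
    (fun j => lam (Fin.castLE hle j)) (fun j => hlam _)
    (fun i j hij => Fin.castLE_injective hle (hinj hij)) (fun j => hG _)
end
end
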